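/- arXiv:2008.11496 — 5 statements merged into one kernel-verified Lean document; each statement's English description precedes it below -/
import Mathlib

section
/- Write every f ∈ ℂ[z¹,…,zⁿ, z̄¹,…,z̄ⁿ, ℏ] uniquely as f = ∑_β f_β(z,ℏ)·z̄^β (sum over multi-indices β ∈ ℕⁿ, f_β ∈ ℂ[z,ℏ]), and define the Bargmann–Fock action of f on s ∈ ℂ[z¹,…,zⁿ, ℏ] by f ⊛ s := ∑_β ℏ^{|β|} ∂^β( f_β · s ), where ∂^β = ∂^{|β|}/∂z^{β} is the iterated formal partial derivative; equivalently, for a monomial f = z^α z̄^β one has f ⊛ s = ℏ^{|β|} ∂^β(z^α·s), extended ℂ[ℏ]-linearly. Then for all f, g ∈ ℂ[z, z̄, ℏ] and all s ∈ ℂ[z, ℏ]: f ⊛ (g ⊛ s) = (f ⋆ g) ⊛ s, where ⋆ is the Wick product. That is, ⊛ makes ℂ[z,ℏ] a module over the Wick algebra (the Bargmann–Fock representation). -/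
open MvPolynomial

/-- Variable set for the polynomial ring `ℂ[z¹,…,zⁿ, z̄¹,…,z̄ⁿ, ℏ]`:
`Sum.inl (Sum.inl i)` is `zⁱ`, `Sum.inl (Sum.inr i)` is `z̄ⁱ`, and `Sum.inr ()` is `ℏ`. -/
abbrev WickVars (n : ℕ) := (Fin n ⊕ Fin n) ⊕ Unit

/-- The variable `zⁱ`. -/
abbrev zVar {n : ℕ} (i : Fin n) : WickVars n := Sum.inl (Sum.inl i)

/-- The variable `z̄ⁱ`. -/
abbrev zbarVar {n : ℕ} (i : Fin n) : WickVars n := Sum.inl (Sum.inr i)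

/-- The variable `ℏ`. -/
abbrev hbarVar (n : ℕ) : WickVars n := Sum.inr ()

/-- Variable set for the polynomial ring `ℂ[z¹,…,zⁿ, ℏ]`:
`Sum.inl i` is `zⁱ` and `Sum.inr ()` is `ℏ`. -/
abbrev HolVars (n : ℕ) := Fin n ⊕ Unit

/-- Iterated formal partial derivative along a list of variables. -/
noncomputable def pderivList {n : ℕ} (l : List (WickVars n))
    (f : MvPolynomial (WickVars n) ℂ) : MvPolynomial (WickVars n) ℂ :=
  l.foldr (fun v acc => MvPolynomial.pderiv v acc) f

/-- The Wick product
`f ⋆ g = ∑_{k≥0} ((−ℏ)ᵏ/k!) ∑_{i₁,…,i_k} (∂ᵏf/∂z^{i₁}⋯∂z^{i_k})·(∂ᵏg/∂z̄^{i₁}⋯∂z̄^{i_k})`. -/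
noncomputable def wickProd {n : ℕ} (f g : MvPolynomial (WickVars n) ℂ) :
    MvPolynomial (WickVars n) ℂ :=
  ∑ᶠ k : ℕ, (MvPolynomial.C ((k.factorial : ℂ)⁻¹) * (-MvPolynomial.X (hbarVar n)) ^ k) *
    ∑ p : Fin k → Fin n,
      pderivList ((List.ofFn p).map fun i => zVar i) f *
        pderivList ((List.ofFn p).map fun i => zbarVar i) g

/-- The iterated formal partial derivative `∂^β = ∂^{|β|}/∂z^β` on `ℂ[z¹,…,zⁿ, ℏ]`. -/
noncomputable def pderivPow {n : ℕ} (β : Fin n → ℕ) (s : MvPolynomial (HolVars n) ℂ) :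
    MvPolynomial (HolVars n) ℂ :=
  (List.finRange n).foldr
    (fun i acc => (fun t => MvPolynomial.pderiv (Sum.inl i : HolVars n) t)^[β i] acc) s

/-- The Bargmann–Fock action `⊛` of `ℂ[z, z̄, ℏ]` on `ℂ[z, ℏ]`: the monomial
`c·ℏᵏ z^α z̄^β` acts on `s` by `c·ℏᵏ·ℏ^{|β|}·∂^β(z^α·s)`, extended linearly. -/
noncomputable def bfAct {n : ℕ} (f : MvPolynomial (WickVars n) ℂ)
    (s : MvPolynomial (HolVars n) ℂ) : MvPolynomial (HolVars n) ℂ :=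
  ∑ d ∈ f.support,
    (f.coeff d) •
      ((MvPolynomial.X (Sum.inr () : HolVars n)) ^ (d (hbarVar n) + ∑ i, d (zbarVar i)) *
        pderivPow (fun i => d (zbarVar i))
          ((∏ i, (MvPolynomial.X (Sum.inl i : HolVars n)) ^ (d (zVar i))) * s))

namespace BargmannFock

variable {n : ℕ}

theorem pderiv_comm {σ R : Type*} [CommRing R] (i j : σ) (f : MvPolynomial σ R) :
    pderiv i (pderiv j f) = pderiv j (pderiv i f) := by
  classical
  have h : ⁅(pderiv i : Derivation R (MvPolynomial σ R) (MvPolynomial σ R)),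
      (pderiv j : Derivation R _ _)⁆ = 0 := by
    refine MvPolynomial.derivation_ext fun k => ?_
    rw [Derivation.commutator_apply, pderiv_X, pderiv_X]
    by_cases h₁ : k = i <;> by_cases h₂ : k = j <;> simp [Pi.single_apply, h₁, h₂] <;>
      split_ifs <;> simp
  have h' := DFunLike.congr_fun h f
  rwa [Derivation.commutator_apply, Derivation.zero_apply, sub_eq_zero] at h'

/-! ### The bidifferential operators in the Wick product -/

/-- The operator `∑_{i₁,…,i_k} (∂ᵏf/∂z^{i₁}⋯∂z^{i_k})·(∂ᵏg/∂z̄^{i₁}⋯∂z̄^{i_k})`. -/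
noncomputable def bidiff (k : ℕ) (f g : MvPolynomial (WickVars n) ℂ) :
    MvPolynomial (WickVars n) ℂ :=
  ∑ p : Fin k → Fin n,
    pderivList ((List.ofFn p).map fun i => zVar i) f *
      pderivList ((List.ofFn p).map fun i => zbarVar i) g

theorem bidiff_zero (f g : MvPolynomial (WickVars n) ℂ) : bidiff 0 f g = f * g := by
  simp [bidiff, pderivList]

theorem bidiff_succ (k : ℕ) (f g : MvPolynomial (WickVars n) ℂ) :
    bidiff (k + 1) f g = ∑ i, bidiff k (pderiv (zVar i) f) (pderiv (zbarVar i) g) := by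
  unfold bidiff
  rw [← (Fin.snocEquiv fun _ => Fin n).sum_comp, Fintype.sum_prod_type]
  refine Finset.sum_congr rfl fun i _ => Finset.sum_congr rfl fun p _ => ?_
  simp [Fin.snocEquiv, List.ofFn_succ_last, pderivList, -List.ofFn_succ]

theorem bidiff_add_left (k : ℕ) (f f' g : MvPolynomial (WickVars n) ℂ) :
    bidiff k (f + f') g = bidiff k f g + bidiff k f' g := by
  induction k generalizing f f' g with
  | zero => simp [bidiff_zero, add_mul]
  | succ k ih => simp [bidiff_succ, ih, Finset.sum_add_distrib]

theorem bidiff_sub_right (k : ℕ) (f g g' : MvPolynomial (WickVars n) ℂ) :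
    bidiff k f (g - g') = bidiff k f g - bidiff k f g' := by
  induction k generalizing f g g' with
  | zero => simp [bidiff_zero, mul_sub]
  | succ k ih => simp [bidiff_succ, ih, Finset.sum_sub_distrib]

theorem bidiff_zero_left (k : ℕ) (g : MvPolynomial (WickVars n) ℂ) : bidiff k 0 g = 0 := by
  have h := bidiff_add_left k 0 0 g
  simpa using h

theorem bidiff_mul_left (k : ℕ) {a : MvPolynomial (WickVars n) ℂ}
    (ha : ∀ i, pderiv (zVar i) a = 0) (f g : MvPolynomial (WickVars n) ℂ) :
    bidiff k (f * a) g = bidiff k f g * a := by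
  induction k generalizing f g with
  | zero => simp only [bidiff_zero]; ring
  | succ k ih => simp only [bidiff_succ, pderiv_mul, ha, mul_zero, add_zero, ih, Finset.sum_mul]

theorem bidiff_mul_right (k : ℕ) {a : MvPolynomial (WickVars n) ℂ}
    (ha : ∀ i, pderiv (zbarVar i) a = 0) (f g : MvPolynomial (WickVars n) ℂ) :
    bidiff k f (g * a) = bidiff k f g * a := by
  induction k generalizing f g with
  | zero => simp only [bidiff_zero]; ring
  | succ k ih => simp only [bidiff_succ, pderiv_mul, ha, mul_zero, add_zero, ih, Finset.sum_mul]

theorem bidiff_succ_mul_zVar (k : ℕ) (i : Fin n) (f g : MvPolynomial (WickVars n) ℂ) :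
    bidiff (k + 1) (f * X (zVar i)) g =
      bidiff (k + 1) f g * X (zVar i) +
        ((k : MvPolynomial (WickVars n) ℂ) + 1) * bidiff k f (pderiv (zbarVar i) g) := by
  have leibniz (k : ℕ) (f g : MvPolynomial (WickVars n) ℂ) :
      bidiff (k + 1) (f * X (zVar i)) g =
        ∑ j, bidiff k (pderiv (zVar j) f * X (zVar i)) (pderiv (zbarVar j) g) +
          bidiff k f (pderiv (zbarVar i) g) := by
    have h (j : Fin n) : pderiv (zVar j) (f * X (zVar i)) =
        pderiv (zVar j) f * X (zVar i) + if j = i then f else 0 := by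
      rw [pderiv_mul]
      split_ifs with hji
      · rw [hji, pderiv_X_self, mul_one]
      · rw [pderiv_X_of_ne (by simpa using Ne.symm hji), mul_zero]
    have h' (j : Fin n) : bidiff k (if j = i then f else 0) (pderiv (zbarVar j) g) =
        if j = i then bidiff k f (pderiv (zbarVar j) g) else 0 := by
      split_ifs
      · rfl
      · exact bidiff_zero_left k _
    simp only [bidiff_succ, h, bidiff_add_left, Finset.sum_add_distrib, h', Finset.sum_ite_eq',
      Finset.mem_univ, if_true]
  induction k generalizing f g with
  | zero =>
    rw [leibniz]
    simp [bidiff_succ, bidiff_zero, Finset.sum_mul, mul_right_comm]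
  | succ k ih =>
    rw [leibniz, bidiff_succ (k + 1) f, bidiff_succ k f (pderiv (zbarVar i) g)]
    simp only [ih, Finset.sum_add_distrib, Finset.sum_mul, Finset.mul_sum,
      pderiv_comm (zbarVar i), Nat.cast_add, Nat.cast_one, add_mul, one_mul]
    ring

theorem exists_bidiff_eq_zero (f : MvPolynomial (WickVars n) ℂ) :
    ∃ N, ∀ k, N ≤ k → ∀ g, bidiff k f g = 0 := by
  induction f using MvPolynomial.induction_on with
  | C a =>
    refine ⟨1, fun k hk g => ?_⟩
    obtain ⟨k, rfl⟩ := Nat.exists_eq_add_of_le' hk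
    simp [bidiff_succ, bidiff_zero_left]
  | add p q hp hq =>
    obtain ⟨N, hN⟩ := hp
    obtain ⟨N', hN'⟩ := hq
    refine ⟨max N N', fun k hk g => ?_⟩
    rw [bidiff_add_left, hN k (le_of_max_le_left hk), hN' k (le_of_max_le_right hk), add_zero]
  | mul_X p v hp =>
    obtain ⟨N, hN⟩ := hp
    refine ⟨N + 1, fun k hk g => ?_⟩
    obtain ⟨k, rfl⟩ := Nat.exists_eq_add_of_le' (Nat.le_trans (Nat.le_add_left 1 N) hk)
    rcases v with (i | i) | ⟨⟩
    · rw [bidiff_succ_mul_zVar, hN _ (by omega), hN _ (by omega)]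
      simp
    · rw [bidiff_mul_left _ (fun j => pderiv_X_of_ne (by simp)), hN _ (by omega), zero_mul]
    · rw [bidiff_mul_left _ (fun j => pderiv_X_of_ne (by simp)), hN _ (by omega), zero_mul]

/-! ### Algebraic properties of the Wick product -/

theorem exists_wickProd_eq_sum (f : MvPolynomial (WickVars n) ℂ) :
    ∃ N, ∀ m, N ≤ m → ∀ g, wickProd f g = ∑ k ∈ Finset.range m,
      (C ((k.factorial : ℂ)⁻¹) * (-X (hbarVar n)) ^ k) * bidiff k f g := by
  obtain ⟨N, hN⟩ := exists_bidiff_eq_zero f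
  refine ⟨N, fun m hm g => finsum_eq_sum_of_support_subset _ fun k hk => ?_⟩
  by_contra h
  refine hk ?_
  change _ * bidiff k f g = 0
  rw [hN k (by simp at h; omega), mul_zero]

theorem wickProd_add_left (f f' g : MvPolynomial (WickVars n) ℂ) :
    wickProd (f + f') g = wickProd f g + wickProd f' g := by
  obtain ⟨N₁, h₁⟩ := exists_wickProd_eq_sum f
  obtain ⟨N₂, h₂⟩ := exists_wickProd_eq_sum f'
  obtain ⟨N₃, h₃⟩ := exists_wickProd_eq_sum (f + f')
  rw [h₁ (N₁ + N₂ + N₃) (by omega), h₂ (N₁ + N₂ + N₃) (by omega),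
    h₃ (N₁ + N₂ + N₃) (by omega), ← Finset.sum_add_distrib]
  simp only [bidiff_add_left, mul_add]

theorem wickProd_mul_left {a : MvPolynomial (WickVars n) ℂ}
    (ha : ∀ i, pderiv (zVar i) a = 0) (f g : MvPolynomial (WickVars n) ℂ) :
    wickProd (f * a) g = wickProd f g * a := by
  obtain ⟨N₁, h₁⟩ := exists_wickProd_eq_sum f
  obtain ⟨N₂, h₂⟩ := exists_wickProd_eq_sum (f * a)
  rw [h₁ (N₁ + N₂) (by omega), h₂ (N₁ + N₂) (by omega), Finset.sum_mul]
  simp only [bidiff_mul_left _ ha, mul_assoc]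

theorem wickProd_C_left (a : ℂ) (g : MvPolynomial (WickVars n) ℂ) :
    wickProd (C a) g = C a * g := by
  obtain ⟨N, h⟩ := exists_wickProd_eq_sum (n := n) (C a)
  rw [h (N + 1) (by omega), Finset.sum_range_succ']
  simp [bidiff_succ, bidiff_zero, bidiff_zero_left]

theorem wickProd_mul_zVar (i : Fin n) (f g : MvPolynomial (WickVars n) ℂ) :
    wickProd (f * X (zVar i)) g =
      wickProd f (g * X (zVar i) - pderiv (zbarVar i) g * X (hbarVar n)) := by
  obtain ⟨N₁, h₁⟩ := exists_wickProd_eq_sum f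
  obtain ⟨N₂, h₂⟩ := exists_wickProd_eq_sum (f * X (zVar i))
  obtain ⟨N₃, h₃⟩ := exists_bidiff_eq_zero f
  have hz (j : Fin n) : pderiv (zbarVar j) (X (zVar i) : MvPolynomial (WickVars n) ℂ) = 0 :=
    pderiv_X_of_ne (by simp)
  have hh (j : Fin n) : pderiv (zbarVar j) (X (hbarVar n) : MvPolynomial (WickVars n) ℂ) = 0 :=
    pderiv_X_of_ne (by simp)
  rw [h₁ (N₁ + N₂ + N₃ + 1) (by omega), h₂ (N₁ + N₂ + N₃ + 1) (by omega)]
  simp only [bidiff_sub_right, bidiff_mul_right _ hz, bidiff_mul_right _ hh, mul_sub,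
    Finset.sum_sub_distrib]
  rw [Finset.sum_range_succ (fun k => _ * (bidiff k f (pderiv (zbarVar i) g) * _)),
    h₃ (N₁ + N₂ + N₃) (by omega), Finset.sum_range_succ', Finset.sum_range_succ', zero_mul,
    mul_zero, add_zero, add_sub_right_comm, ← Finset.sum_sub_distrib]
  congr 1
  · refine Finset.sum_congr rfl fun k _ => ?_
    have hk : C (((k + 1).factorial : ℂ)⁻¹) * ((k : MvPolynomial (WickVars n) ℂ) + 1) =
        C ((k.factorial : ℂ)⁻¹) := by
      rw [← map_natCast C k, ← C_1, ← C_add, ← C_mul, Nat.factorial_succ]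
      congr 1
      have h₁ : (k : ℂ) + 1 ≠ 0 := Nat.cast_add_one_ne_zero k
      have h₂ : (k.factorial : ℂ) ≠ 0 := Nat.cast_ne_zero.mpr k.factorial_ne_zero
      push_cast
      field_simp
    rw [bidiff_succ_mul_zVar, ← hk]
    ring
  · simp only [bidiff_zero]
    ring

/-! ### The iterated derivative and the Bargmann–Fock action -/

theorem pderivPow_zero (s : MvPolynomial (HolVars n) ℂ) : pderivPow 0 s = s := by
  simp [pderivPow]

theorem pderivPow_add_single (β : Fin n → ℕ) (i : Fin n) (s : MvPolynomial (HolVars n) ℂ) :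
    pderivPow (β + Pi.single i 1) s = pderiv (Sum.inl i) (pderivPow β s) := by
  have comm (j : Fin n) (m m' : ℕ) (t : MvPolynomial (HolVars n) ℂ) :
      (fun t => pderiv (Sum.inl j : HolVars n) t)^[m]
        ((fun t => pderiv (Sum.inl i : HolVars n) t)^[m'] t) =
      (fun t => pderiv (Sum.inl i : HolVars n) t)^[m']
        ((fun t => pderiv (Sum.inl j : HolVars n) t)^[m] t) :=
    Function.Commute.iterate_iterate (fun t => pderiv_comm _ _ t) m m' t
  have key (l : List (Fin n)) :
      l.foldr (fun j acc =>
          (fun t => pderiv (Sum.inl j : HolVars n) t)^[(β + Pi.single i 1 : Fin n → ℕ) j] acc) s = (fun t => pderiv (Sum.inl i : HolVars n) t)^[l.count i]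
          (l.foldr (fun j acc => (fun t => pderiv (Sum.inl j : HolVars n) t)^[β j] acc) s) := by
    induction l with
    | nil => rfl
    | cons j l ih =>
      rw [List.foldr_cons, List.foldr_cons, ih, comm]
      by_cases h : j = i
      · subst h
        rw [List.count_cons_self, Pi.add_apply, Pi.single_eq_same, ← Function.iterate_add_apply,
          ← Function.iterate_add_apply, add_assoc, add_comm 1]
      · rw [List.count_cons_of_ne h, Pi.add_apply, Pi.single_eq_of_ne h, add_zero]
  have h := key (List.finRange n)
  rwa [List.count_finRange, Function.iterate_one] at h

theorem bfAct_monomial (d : WickVars n →₀ ℕ) (c : ℂ) (s : MvPolynomial (HolVars n) ℂ) :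
    bfAct (monomial d c) s = c •
      ((X (Sum.inr () : HolVars n)) ^ (d (hbarVar n) + ∑ i, d (zbarVar i)) *
        pderivPow (fun i => d (zbarVar i))
          ((∏ i, (X (Sum.inl i : HolVars n)) ^ (d (zVar i))) * s)) := by
  classical
  by_cases hc : c = 0
  · simp [bfAct, hc]
  · simp [bfAct, support_monomial, hc]

theorem bfAct_add (f g : MvPolynomial (WickVars n) ℂ) (s : MvPolynomial (HolVars n) ℂ) :
    bfAct (f + g) s = bfAct f s + bfAct g s := by
  unfold bfAct
  rw [← sum_def (b := fun d (c : ℂ) => c • _), ← sum_def (b := fun d (c : ℂ) => c • _),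
    ← sum_def (b := fun d (c : ℂ) => c • _), AddMonoidAlgebra.coeff_add]
  exact Finsupp.sum_add_index' (fun _ => zero_smul _ _) (fun _ _ _ => add_smul _ _ _)

theorem bfAct_sub (f g : MvPolynomial (WickVars n) ℂ) (s : MvPolynomial (HolVars n) ℂ) :
    bfAct (f - g) s = bfAct f s - bfAct g s := by
  rw [eq_sub_iff_add_eq, ← bfAct_add, sub_add_cancel]

theorem bfAct_C_mul (a : ℂ) (f : MvPolynomial (WickVars n) ℂ) (s : MvPolynomial (HolVars n) ℂ) :
    bfAct (C a * f) s = a • bfAct f s := by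
  induction f using MvPolynomial.induction_on' with
  | monomial d c => rw [C_mul_monomial, bfAct_monomial, bfAct_monomial, mul_smul]
  | add p q hp hq => rw [mul_add, bfAct_add, bfAct_add, hp, hq, smul_add]

theorem bfAct_C (a : ℂ) (s : MvPolynomial (HolVars n) ℂ) : bfAct (C a) s = a • s := by
  have h : (fun _ : Fin n => 0) = 0 := rfl
  rw [C_apply, bfAct_monomial]
  simp [h, pderivPow_zero]

theorem bfAct_mul_zVar (i : Fin n) (f : MvPolynomial (WickVars n) ℂ)
    (s : MvPolynomial (HolVars n) ℂ) :
    bfAct (f * X (zVar i)) s = bfAct f (s * X (Sum.inl i)) := by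
  induction f using MvPolynomial.induction_on' with
  | monomial d c =>
    rw [X, monomial_mul, mul_one, bfAct_monomial, bfAct_monomial]
    congr 2
    · simp
    · congr 1
      · simp
      · have h (j : Fin n) : (d + Finsupp.single (zVar i) 1 : WickVars n →₀ ℕ) (zVar j) =
            d (zVar j) + if i = j then 1 else 0 := by
          simp [Finsupp.single_apply]
        simp only [h, pow_add, Finset.prod_mul_distrib, pow_ite, pow_one, pow_zero,
          Finset.prod_ite_eq, Finset.mem_univ, if_true]
        ring
  | add p q hp hq => rw [add_mul, bfAct_add, bfAct_add, hp, hq]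

theorem bfAct_mul_zbarVar (i : Fin n) (f : MvPolynomial (WickVars n) ℂ)
    (s : MvPolynomial (HolVars n) ℂ) :
    bfAct (f * X (zbarVar i)) s = X (Sum.inr ()) * pderiv (Sum.inl i) (bfAct f s) := by
  induction f using MvPolynomial.induction_on' with
  | monomial d c =>
    have h (j : Fin n) : (d + Finsupp.single (zbarVar i) 1 : WickVars n →₀ ℕ) (zbarVar j) =
        d (zbarVar j) + (Pi.single i 1 : Fin n → ℕ) j := by
      simp [Finsupp.single_apply, Pi.single_apply, eq_comm]
    have h' : (fun j => (d + Finsupp.single (zbarVar i) 1 : WickVars n →₀ ℕ) (zbarVar j)) =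
        (fun j => d (zbarVar j)) + (Pi.single i 1 : Fin n → ℕ) := funext h
    have hsum : ∑ j, (d + Finsupp.single (zbarVar i) 1 : WickVars n →₀ ℕ) (zbarVar j) =
        ∑ j, d (zbarVar j) + 1 := by
      simp [h, Finset.sum_add_distrib]
    rw [X, monomial_mul, mul_one, bfAct_monomial, bfAct_monomial, hsum, h', pderivPow_add_single,
      Derivation.map_smul, pderiv_mul, pderiv_pow, pderiv_X_of_ne (by simp)]
    simp only [Finsupp.add_apply, Finsupp.single_apply, reduceCtorEq, Sum.inl.injEq, if_false,
      add_zero, mul_zero, zero_mul, zero_add, mul_smul_comm]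
    ring_nf
  | add p q hp hq => rw [add_mul, bfAct_add, bfAct_add, hp, hq, map_add, mul_add]

theorem bfAct_mul_hbarVar (f : MvPolynomial (WickVars n) ℂ) (s : MvPolynomial (HolVars n) ℂ) :
    bfAct (f * X (hbarVar n)) s = X (Sum.inr ()) * bfAct f s := by
  induction f using MvPolynomial.induction_on' with
  | monomial d c =>
    rw [X, monomial_mul, mul_one, bfAct_monomial, bfAct_monomial]
    simp only [Finsupp.add_apply, Finsupp.single_apply, reduceCtorEq, if_true, if_false,
      add_zero, mul_smul_comm]
    congr 1
    ring
  | add p q hp hq => rw [add_mul, bfAct_add, bfAct_add, hp, hq, mul_add]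

theorem X_mul_bfAct (i : Fin n) (g : MvPolynomial (WickVars n) ℂ)
    (s : MvPolynomial (HolVars n) ℂ) :
    X (Sum.inl i) * bfAct g s =
      bfAct (g * X (zVar i) - pderiv (zbarVar i) g * X (hbarVar n)) s := by
  rw [bfAct_sub, bfAct_mul_zVar, bfAct_mul_hbarVar]
  induction g using MvPolynomial.induction_on generalizing s with
  | C a =>
    have h := bfAct_C (n := n) 0 s
    rw [C_0, zero_smul] at h
    rw [pderiv_C, h, bfAct_C, bfAct_C, mul_zero, sub_zero, mul_smul_comm, mul_comm]
  | add p q hp hq =>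
    rw [bfAct_add, map_add, bfAct_add, bfAct_add, mul_add, hp, hq]
    ring
  | mul_X p v hp =>
    rcases v with (j | j) | ⟨⟩
    · rw [pderiv_mul, pderiv_X_of_ne (by simp), mul_zero, add_zero, bfAct_mul_zVar,
        bfAct_mul_zVar, bfAct_mul_zVar, hp, mul_right_comm]
    · have hp' : bfAct p (s * X (Sum.inl i)) = X (Sum.inl i) * bfAct p s +
          X (Sum.inr ()) * bfAct (pderiv (zbarVar i) p) s := by
        rw [hp]; ring
      rw [bfAct_mul_zbarVar, bfAct_mul_zbarVar, hp', pderiv_mul, bfAct_add, bfAct_mul_zbarVar,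
        map_add, pderiv_mul, pderiv_mul,
        pderiv_X_of_ne (show (Sum.inr () : HolVars n) ≠ Sum.inl j by simp)]
      by_cases h : i = j
      · subst h
        rw [pderiv_X_self, pderiv_X_self, mul_one]
        ring
      · have h0 := bfAct_C (n := n) 0 s
        rw [C_0, zero_smul] at h0
        rw [pderiv_X_of_ne (by simpa using h), pderiv_X_of_ne (by simpa using Ne.symm h), mul_zero,
          h0]
        ring
    · rw [pderiv_mul, pderiv_X_of_ne (by simp), mul_zero, add_zero, bfAct_mul_hbarVar,
        bfAct_mul_hbarVar, bfAct_mul_hbarVar, mul_left_comm, hp]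
      ring

end BargmannFock

open BargmannFock in
/-- The Bargmann–Fock action makes `ℂ[z,ℏ]` a module over the Wick algebra:
`f ⊛ (g ⊛ s) = (f ⋆ g) ⊛ s`. -/
theorem bfAct_wickProd (n : ℕ) (f g : MvPolynomial (WickVars n) ℂ)
    (s : MvPolynomial (HolVars n) ℂ) :
    bfAct f (bfAct g s) = bfAct (wickProd f g) s := by
  induction f using MvPolynomial.induction_on generalizing g with
  | C a => rw [wickProd_C_left, bfAct_C_mul, bfAct_C]
  | add p q hp hq => rw [wickProd_add_left, bfAct_add, bfAct_add, hp, hq]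
  | mul_X p v hp =>
    rcases v with (i | i) | ⟨⟩
    · rw [bfAct_mul_zVar, mul_comm, X_mul_bfAct, hp, wickProd_mul_zVar]
    · rw [bfAct_mul_zbarVar, hp, wickProd_mul_left (fun j => pderiv_X_of_ne (by simp)),
        bfAct_mul_zbarVar]
    · rw [bfAct_mul_hbarVar, hp, wickProd_mul_left (fun j => pderiv_X_of_ne (by simp)),
        bfAct_mul_hbarVar]
end

section
/- Let ρ be a smooth real-valued function on an open neighborhood U of 0 in ℂⁿ, and for multi-indices I, J ∈ ℕⁿ write ∂^I ∂̄^J ρ for the iterated Wirtinger derivatives, where ∂/∂zⁱ = ½(∂/∂xⁱ − √−1·∂/∂yⁱ) and ∂/∂z̄ⁱ = ½(∂/∂xⁱ + √−1·∂/∂yⁱ) with zⁱ = xⁱ + √−1·yⁱ. Assume ρ is in Kähler normal form (K-coordinates) at 0: ∂^I ∂̄^J ρ(0) = 0 for all pairs (I, J) with |I| + |J| ≥ 0 except those with |I| ≥ 2 and |J| ≥ 2 or with |I| = |J| = 1, and ∂_{zⁱ} ∂_{z̄ʲ} ρ(0) = δ_{ij} for 1 ≤ i, j ≤ n. Let h :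 U → ℂ be the determinant of the n×n matrix with (i,j)-entry ∂²ρ/∂zⁱ∂z̄ʲ. Then h(0) = 1, and all purely holomorphic and purely anti-holomorphic derivatives of h of positive order vanish at 0: ∂^I h(0) = 0 and ∂̄^J h(0) = 0 for all multi-indices I, J with |I| ≥ 1, |J| ≥ 1. -/
open Complex

/-- The Wirtinger derivative `∂f/∂zⁱ = ½(∂f/∂xⁱ − √−1·∂f/∂yⁱ)` of a function on
`ℂⁿ ≅ (Fin n → ℂ)`, via the real Fréchet derivative. -/
noncomputable def wirtingerDz {n : ℕ} (i : Fin n) (f : (Fin n → ℂ) → ℂ) :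
    (Fin n → ℂ) → ℂ := fun z =>
  (1 / 2 : ℂ) * (fderiv ℝ f z (Pi.single i 1) - Complex.I * fderiv ℝ f z (Pi.single i Complex.I))

/-- The Wirtinger derivative `∂f/∂z̄ⁱ = ½(∂f/∂xⁱ + √−1·∂f/∂yⁱ)`. -/
noncomputable def wirtingerDzbar {n : ℕ} (i : Fin n) (f : (Fin n → ℂ) → ℂ) :
    (Fin n → ℂ) → ℂ := fun z =>
  (1 / 2 : ℂ) * (fderiv ℝ f z (Pi.single i 1) + Complex.I * fderiv ℝ f z (Pi.single i Complex.I))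

/-- Iterated Wirtinger derivative `∂^I` for a multi-index `I`. -/
noncomputable def wirtingerDzPow {n : ℕ} (I : Fin n → ℕ) (f : (Fin n → ℂ) → ℂ) :
    (Fin n → ℂ) → ℂ :=
  (List.finRange n).foldr (fun i acc => (wirtingerDz i)^[I i] acc) f

/-- Iterated Wirtinger derivative `∂̄^J` for a multi-index `J`. -/
noncomputable def wirtingerDzbarPow {n : ℕ} (J : Fin n → ℕ) (f : (Fin n → ℂ) → ℂ) :
    (Fin n → ℂ) → ℂ :=
  (List.finRange n).foldr (fun i acc => (wirtingerDzbar i)^[J i] acc) f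

namespace Wirtinger

open scoped ContDiff

variable {n : ℕ} {U : Set (Fin n → ℂ)} {f g : (Fin n → ℂ) → ℂ}

/-- The operator `½(∂/∂xⁱ + a ∂/∂yⁱ)` for `p = (a, i)`; it is `∂/∂zⁱ` for `a = -√−1` and
`∂/∂z̄ⁱ` for `a = √−1`. -/
noncomputable def deriv (p : ℂ × Fin n) (f : (Fin n → ℂ) → ℂ) : (Fin n → ℂ) → ℂ := fun z =>
  (1 / 2 : ℂ) * (fderiv ℝ f z (Pi.single p.2 1) + p.1 * fderiv ℝ f z (Pi.single p.2 Complex.I))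

/-- The composition of the operators `Wirtinger.deriv p` for `p` in a list. -/
noncomputable def iter (L : List (ℂ × Fin n)) (f : (Fin n → ℂ) → ℂ) : (Fin n → ℂ) → ℂ :=
  L.foldr deriv f

lemma wirtingerDz_eq (i : Fin n) : wirtingerDz i = deriv (-Complex.I, i) := by
  funext f z
  simp only [wirtingerDz, deriv]
  ring

lemma wirtingerDzbar_eq (i : Fin n) : wirtingerDzbar i = deriv (Complex.I, i) := rfl

lemma deriv_congr (hU : IsOpen U) (p : ℂ × Fin n) (h : Set.EqOn f g U) :
    Set.EqOn (deriv p f) (deriv p g) U := by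
  intro z hz
  simp only [deriv, (h.eventuallyEq_of_mem (hU.mem_nhds hz)).fderiv_eq]

lemma iter_congr (hU : IsOpen U) (L : List (ℂ × Fin n)) (h : Set.EqOn f g U) :
    Set.EqOn (iter L f) (iter L g) U := by
  induction L with
  | nil => exact h
  | cons p L ih => exact deriv_congr hU p ih

lemma contDiffOn_deriv (hU : IsOpen U) (p : ℂ × Fin n) (hf : ContDiffOn ℝ ∞ f U) :
    ContDiffOn ℝ ∞ (deriv p f) U := by
  have h : ContDiffOn ℝ ∞ (fderiv ℝ f) U := hf.fderiv_of_isOpen hU (by simp)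
  unfold deriv
  fun_prop

lemma contDiffOn_iter (hU : IsOpen U) (L : List (ℂ × Fin n)) (hf : ContDiffOn ℝ ∞ f U) :
    ContDiffOn ℝ ∞ (iter L f) U := by
  induction L with
  | nil => exact hf
  | cons p L ih => exact contDiffOn_deriv hU p ih

lemma differentiableAt_of_contDiffOn (hU : IsOpen U) (hf : ContDiffOn ℝ ∞ f U) {z : Fin n → ℂ}
    (hz : z ∈ U) : DifferentiableAt ℝ f z :=
  (hf.contDiffAt (hU.mem_nhds hz)).differentiableAt (by simp)

lemma deriv_add (hU : IsOpen U) (p : ℂ × Fin n) (hf : ContDiffOn ℝ ∞ f U)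
    (hg : ContDiffOn ℝ ∞ g U) : Set.EqOn (deriv p (f + g)) (deriv p f + deriv p g) U := by
  intro z hz
  simp only [deriv, Pi.add_apply, fderiv_add (differentiableAt_of_contDiffOn hU hf hz)
    (differentiableAt_of_contDiffOn hU hg hz), add_apply]
  ring

lemma deriv_mul (hU : IsOpen U) (p : ℂ × Fin n) (hf : ContDiffOn ℝ ∞ f U)
    (hg : ContDiffOn ℝ ∞ g U) :
    Set.EqOn (deriv p (f * g)) (deriv p f * g + f * deriv p g) U := by
  intro z hz
  simp only [deriv, Pi.add_apply, Pi.mul_apply,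
    fderiv_mul (differentiableAt_of_contDiffOn hU hf hz)
    (differentiableAt_of_contDiffOn hU hg hz), add_apply,
    smul_apply, smul_eq_mul]
  ring

lemma deriv_const (p : ℂ × Fin n) (c : ℂ) : deriv p (fun _ => c) = 0 := by
  funext z
  simp [deriv]

lemma deriv_comm (hU : IsOpen U) (p q : ℂ × Fin n) (hf : ContDiffOn ℝ ∞ f U) :
    Set.EqOn (deriv p (deriv q f)) (deriv q (deriv p f)) U := by
  intro z hz
  have hd : DifferentiableAt ℝ (fderiv ℝ f) z :=
    ((hf.fderiv_of_isOpen hU (m := ∞) (by simp)).contDiffAt (hU.mem_nhds hz)).differentiableAt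
      (by simp)
  have hs : IsSymmSndFDerivAt ℝ f z :=
    (hf.contDiffAt (hU.mem_nhds hz)).isSymmSndFDerivAt (by
      rw [minSmoothness_of_isRCLikeNormedField]
      exact WithTop.coe_le_coe.2 le_top)
  have key : ∀ (r : ℂ × Fin n) (v : Fin n → ℂ), fderiv ℝ (deriv r f) z v =
      (1 / 2 : ℂ) * (fderiv ℝ (fderiv ℝ f) z v (Pi.single r.2 1) +
        r.1 * fderiv ℝ (fderiv ℝ f) z v (Pi.single r.2 Complex.I)) := by
    intro r v
    have happ : ∀ w : Fin n → ℂ, HasFDerivAt (fun y => fderiv ℝ f y w)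
        ((fderiv ℝ (fderiv ℝ f) z).flip w) z := fun w => by
      simpa using hd.hasFDerivAt.clm_apply (hasFDerivAt_const w z)
    have hr := ((happ (Pi.single r.2 1)).add
      ((happ (Pi.single r.2 Complex.I)).const_mul r.1)).const_mul (1 / 2 : ℂ)
    have hr' : fderiv ℝ (deriv r f) z = _ := hr.fderiv
    simp [hr', mul_add]
  change (1 / 2 : ℂ) * (fderiv ℝ (deriv q f) z _ + _ * fderiv ℝ (deriv q f) z _) =
    (1 / 2 : ℂ) * (fderiv ℝ (deriv p f) z _ + _ * fderiv ℝ (deriv p f) z _)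
  simp only [key]
  rw [hs (Pi.single p.2 1) (Pi.single q.2 1), hs (Pi.single p.2 1) (Pi.single q.2 Complex.I),
    hs (Pi.single p.2 Complex.I) (Pi.single q.2 1),
    hs (Pi.single p.2 Complex.I) (Pi.single q.2 Complex.I)]
  ring

lemma iter_perm (hU : IsOpen U) {L M : List (ℂ × Fin n)} (h : L.Perm M)
    (hf : ContDiffOn ℝ ∞ f U) : Set.EqOn (iter L f) (iter M f) U := by
  induction h with
  | nil => exact fun _ _ => rfl
  | cons p _ ih => exact deriv_congr hU p ih
  | swap p q L => exact deriv_comm hU q p (contDiffOn_iter hU L hf)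
  | trans _ _ ih₁ ih₂ => exact ih₁.trans ih₂

lemma iter_append (L M : List (ℂ × Fin n)) : iter (L ++ M) f = iter L (iter M f) :=
  List.foldr_append ..

/-- The list in which the index `i` is repeated `I i` times. -/
def expand (I : Fin n → ℕ) : List (Fin n) :=
  (List.finRange n).flatMap fun i => List.replicate (I i) i

lemma foldr_iterate_eq_iter (a : ℂ) (I : Fin n → ℕ) (l : List (Fin n)) :
    l.foldr (fun i acc => (deriv (a, i))^[I i] acc) f =
      iter ((l.flatMap fun i => List.replicate (I i) i).map (a, ·)) f := by
  have hrep : ∀ (k : ℕ) (i : Fin n) (g : (Fin n → ℂ) → ℂ),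
      (deriv (a, i))^[k] g = iter (List.replicate k (a, i)) g := by
    intro k i g
    induction k with
    | zero => rfl
    | succ k ih => rw [Function.iterate_succ_apply', ih]; rfl
  induction l with
  | nil => rfl
  | cons i l ih =>
    rw [List.foldr_cons, ih, List.flatMap_cons, List.map_append, iter_append, hrep,
      List.map_replicate]

lemma wirtingerDzPow_eq (I : Fin n → ℕ) :
    wirtingerDzPow I f = iter ((expand I).map (-Complex.I, ·)) f := by
  simp only [wirtingerDzPow, wirtingerDz_eq]
  exact foldr_iterate_eq_iter ..

lemma wirtingerDzbarPow_eq (I : Fin n → ℕ) :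
    wirtingerDzbarPow I f = iter ((expand I).map (Complex.I, ·)) f :=
  foldr_iterate_eq_iter ..

lemma count_expand (I : Fin n → ℕ) (i : Fin n) : (expand I).count i = I i := by
  simp [expand, List.count_flatMap, Function.comp_def, List.count_replicate,
    ← Fin.sum_univ_def]

lemma length_expand (I : Fin n → ℕ) : (expand I).length = ∑ i, I i := by
  simp [expand, List.length_flatMap, Fin.sum_univ_def]

lemma expand_count_perm (L : List (Fin n)) : (expand fun i => L.count i).Perm L :=
  List.perm_iff_count.2 fun i => count_expand _ i

/-- All derivatives of `f` along `½(∂/∂xⁱ + a ∂/∂yⁱ)`, including `f` itself, vanish at `0`. -/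
def Flat (a : ℂ) (f : (Fin n → ℂ) → ℂ) : Prop :=
  ∀ L : List (Fin n), iter (L.map (a, ·)) f 0 = 0

/-- `f` is smooth on `U` and its derivatives of positive order along `½(∂/∂xⁱ + a ∂/∂yⁱ)`
vanish at `0`. -/
def FlatDeriv (U : Set (Fin n → ℂ)) (a : ℂ) (f : (Fin n → ℂ) → ℂ) : Prop :=
  ContDiffOn ℝ ∞ f U ∧ ∀ i, Flat a (deriv (a, i) f)

variable {a : ℂ}

lemma Flat.congr (hU : IsOpen U) (h0 : (0 : Fin n → ℂ) ∈ U) (hf : Flat a f)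
    (h : Set.EqOn g f U) : Flat a g := fun L =>
  (iter_congr hU _ h h0).trans (hf L)

lemma iter_map_concat (L : List (Fin n)) (i : Fin n) :
    iter ((L ++ [i]).map (a, ·)) f = iter (L.map (a, ·)) (deriv (a, i) f) := by
  rw [List.map_append, iter_append]
  rfl

lemma iter_add (hU : IsOpen U) (L : List (ℂ × Fin n)) (hf : ContDiffOn ℝ ∞ f U)
    (hg : ContDiffOn ℝ ∞ g U) : Set.EqOn (iter L (f + g)) (iter L f + iter L g) U := by
  induction L with
  | nil => exact fun _ _ => rfl
  | cons p L ih =>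
    exact (deriv_congr hU p ih).trans
      (deriv_add hU p (contDiffOn_iter hU L hf) (contDiffOn_iter hU L hg))

lemma Flat.add (hU : IsOpen U) (h0 : (0 : Fin n → ℂ) ∈ U) (hf : ContDiffOn ℝ ∞ f U)
    (hg : ContDiffOn ℝ ∞ g U) (hf' : Flat a f) (hg' : Flat a g) : Flat a (f + g) := fun L => by
  rw [iter_add hU _ hf hg h0, Pi.add_apply, hf' L, hg' L, add_zero]

lemma Flat.deriv (hf : Flat a f) (i : Fin n) : Flat a (deriv (a, i) f) := fun L => by
  rw [← iter_map_concat]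
  exact hf _

lemma Flat.mul (hU : IsOpen U) (h0 : (0 : Fin n → ℂ) ∈ U) (hf : ContDiffOn ℝ ∞ f U)
    (hg : ContDiffOn ℝ ∞ g U) (hf' : Flat a f) : Flat a (f * g) := by
  intro L
  induction L using List.reverseRecOn generalizing f g with
  | nil =>
    have : f 0 = 0 := hf' []
    simp [iter, this]
  | append_singleton L i ih =>
    have hdf := contDiffOn_deriv hU (a, i) hf
    have hdg := contDiffOn_deriv hU (a, i) hg
    rw [iter_map_concat, iter_congr hU _ (deriv_mul hU (a, i) hf hg) h0,
      iter_add hU _ (f := Wirtinger.deriv (a, i) f * g) (g := f * Wirtinger.deriv (a, i) g)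
        (hdf.mul hg) (hf.mul hdg) h0, Pi.add_apply, ih hdf hg (hf'.deriv i),
      ih hf hdg hf', add_zero]

lemma flatDeriv_const (c : ℂ) : FlatDeriv U a fun _ => c := by
  refine ⟨contDiffOn_const, fun i L => ?_⟩
  rw [deriv_const]
  change iter _ (fun _ => 0) 0 = 0
  have h : ∀ M : List (ℂ × Fin n), iter M (fun _ => 0) = fun _ => 0 := by
    intro M
    induction M with
    | nil => rfl
    | cons p M ih =>
      change Wirtinger.deriv p (iter M _) = _
      rw [ih, deriv_const]
      rfl
  rw [h]

lemma FlatDeriv.add (hU : IsOpen U) (h0 : (0 : Fin n → ℂ) ∈ U) (hf : FlatDeriv U a f)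
    (hg : FlatDeriv U a g) : FlatDeriv U a (f + g) :=
  ⟨hf.1.add hg.1, fun i => ((hf.2 i).add hU h0 (contDiffOn_deriv hU _ hf.1)
    (contDiffOn_deriv hU _ hg.1) (hg.2 i)).congr hU h0 (deriv_add hU _ hf.1 hg.1)⟩

lemma FlatDeriv.mul (hU : IsOpen U) (h0 : (0 : Fin n → ℂ) ∈ U) (hf : FlatDeriv U a f)
    (hg : FlatDeriv U a g) : FlatDeriv U a (f * g) := by
  refine ⟨hf.1.mul hg.1, fun i => ?_⟩
  have hdf := contDiffOn_deriv hU (a, i) hf.1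
  have hdg := contDiffOn_deriv hU (a, i) hg.1
  have h₂ : Flat a (f * Wirtinger.deriv (a, i) g) := by
    rw [mul_comm]
    exact (hg.2 i).mul hU h0 hdg hf.1
  exact (((hf.2 i).mul hU h0 hdf hg.1).add hU h0 (hdf.mul hg.1) (hf.1.mul hdg) h₂).congr hU h0
    (deriv_mul hU _ hf.1 hg.1)

lemma FlatDeriv.sum (hU : IsOpen U) (h0 : (0 : Fin n → ℂ) ∈ U) {ι : Type*} (s : Finset ι)
    {F : ι → (Fin n → ℂ) → ℂ} (hF : ∀ k ∈ s, FlatDeriv U a (F k)) :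
    FlatDeriv U a (∑ k ∈ s, F k) :=
  Finset.sum_induction _ _ (fun _ _ hf hg => hf.add hU h0 hg) (flatDeriv_const 0) hF

lemma FlatDeriv.prod (hU : IsOpen U) (h0 : (0 : Fin n → ℂ) ∈ U) {ι : Type*} (s : Finset ι)
    {F : ι → (Fin n → ℂ) → ℂ} (hF : ∀ k ∈ s, FlatDeriv U a (F k)) :
    FlatDeriv U a (∏ k ∈ s, F k) :=
  Finset.prod_induction _ _ (fun _ _ hf hg => hf.mul hU h0 hg) (flatDeriv_const 1) hF

lemma FlatDeriv.det (hU : IsOpen U) (h0 : (0 : Fin n → ℂ) ∈ U) {ι : Type*} [Fintype ι]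
    [DecidableEq ι] {G : ι → ι → (Fin n → ℂ) → ℂ} (hG : ∀ i j, FlatDeriv U a (G i j)) :
    FlatDeriv U a fun z => Matrix.det (Matrix.of fun i j => G i j z) := by
  have h : (fun z => Matrix.det (Matrix.of fun i j => G i j z)) =
      ∑ σ : Equiv.Perm ι, (fun _ => ((Equiv.Perm.sign σ : ℤ) : ℂ)) * ∏ i, G (σ i) i := by
    funext z
    simp [Matrix.det_apply', Finset.sum_apply, Finset.prod_apply]
  rw [h]
  exact FlatDeriv.sum hU h0 _ fun σ _ =>
    (flatDeriv_const _).mul hU h0 (FlatDeriv.prod hU h0 _ fun i _ => hG _ _)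

lemma FlatDeriv.iter_eq_zero (hf : FlatDeriv U a f) {L : List (Fin n)} (hL : 1 ≤ L.length) :
    iter (L.map (a, ·)) f 0 = 0 := by
  obtain rfl | ⟨M, i, rfl⟩ := L.eq_nil_or_concat
  · simp at hL
  · rw [List.concat_eq_append, iter_map_concat]
    exact hf.2 i M

end Wirtinger

/-- If `ρ` is a smooth real-valued function near `0 ∈ ℂⁿ` in Kähler normal form
(K-coordinates) at `0`, and `h = det(∂²ρ/∂zⁱ∂z̄ʲ)`, then `h(0) = 1` and all purely
holomorphic and purely anti-holomorphic derivatives of `h` of positive order vanish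
at `0`. -/
theorem det_metric_pure_derivatives_vanish (n : ℕ) (U : Set (Fin n → ℂ))
    (hU : IsOpen U) (h0 : (0 : Fin n → ℂ) ∈ U) (ρ : (Fin n → ℂ) → ℂ)
    (hsmooth : ContDiffOn ℝ (⊤ : ℕ∞) ρ U)
    (hreal : ∀ z ∈ U, (ρ z).im = 0)
    (hnormal : ∀ I J : Fin n → ℕ,
      ¬((2 ≤ ∑ i, I i ∧ 2 ≤ ∑ i, J i) ∨ ((∑ i, I i) = 1 ∧ (∑ i, J i) = 1)) →
      wirtingerDzPow I (wirtingerDzbarPow J ρ) 0 = 0)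
    (hdelta : ∀ i j : Fin n,
      wirtingerDz i (wirtingerDzbar j ρ) 0 = if i = j then 1 else 0)
    (h : (Fin n → ℂ) → ℂ)
    (hdet : ∀ z : Fin n → ℂ,
      h z = Matrix.det (Matrix.of fun i j => wirtingerDz i (wirtingerDzbar j ρ) z)) :
    h 0 = 1 ∧
    (∀ I : Fin n → ℕ, 1 ≤ ∑ i, I i → wirtingerDzPow I h 0 = 0) ∧
    (∀ J : Fin n → ℕ, 1 ≤ ∑ i, J i → wirtingerDzbarPow J h 0 = 0) := by
  have key : ∀ L M : List (Fin n),
      ¬((2 ≤ L.length ∧ 2 ≤ M.length) ∨ (L.length = 1 ∧ M.length = 1)) →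
      Wirtinger.iter (L.map (-Complex.I, ·) ++ M.map (Complex.I, ·)) ρ 0 = 0 := by
    intro L M hLM
    have hp := hnormal (fun i => L.count i) (fun i => M.count i) (by
      rwa [← Wirtinger.length_expand, ← Wirtinger.length_expand,
        (Wirtinger.expand_count_perm L).length_eq, (Wirtinger.expand_count_perm M).length_eq])
    rw [Wirtinger.wirtingerDzPow_eq, Wirtinger.wirtingerDzbarPow_eq, ← Wirtinger.iter_append] at hp
    rw [← hp]
    exact Wirtinger.iter_perm hU (((Wirtinger.expand_count_perm L).map _).append
      ((Wirtinger.expand_count_perm M).map _)).symm hsmooth h0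
  have hentry : ∀ i j : Fin n, wirtingerDz i (wirtingerDzbar j ρ) =
      Wirtinger.iter [(-Complex.I, i), (Complex.I, j)] ρ := fun i j => by
    rw [Wirtinger.wirtingerDz_eq, Wirtinger.wirtingerDzbar_eq]
    rfl
  have hh : h = fun z => Matrix.det (Matrix.of fun i j =>
      Wirtinger.iter [(-Complex.I, i), (Complex.I, j)] ρ z) := by
    funext z
    simp only [hdet, hentry]
  have hhol : Wirtinger.FlatDeriv U (-Complex.I) h := by
    rw [hh]
    refine Wirtinger.FlatDeriv.det hU h0 fun i j =>
      ⟨Wirtinger.contDiffOn_iter hU _ hsmooth, fun k L => ?_⟩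
    rw [← Wirtinger.iter_map_concat, ← Wirtinger.iter_append]
    simpa using key (L ++ [k, i]) [j] (by simp)
  have hanti : Wirtinger.FlatDeriv U Complex.I h := by
    rw [hh]
    refine Wirtinger.FlatDeriv.det hU h0 fun i j =>
      ⟨Wirtinger.contDiffOn_iter hU _ hsmooth, fun k L => ?_⟩
    rw [← Wirtinger.iter_map_concat, ← Wirtinger.iter_append,
      ← key [i] (L ++ [k, j]) (by simp)]
    refine Wirtinger.iter_perm hU ?_ hsmooth h0
    simpa using (List.perm_middle (a := (-Complex.I, i))
      (l₁ := L.map (Complex.I, ·) ++ [(Complex.I, k)]) (l₂ := [(Complex.I, j)]))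
  refine ⟨?_, fun I hI => ?_, fun J hJ => ?_⟩
  · have hone : (Matrix.of fun i j => wirtingerDz i (wirtingerDzbar j ρ) 0) =
        (1 : Matrix (Fin n) (Fin n) ℂ) := by
      ext i j
      simp [hdelta, Matrix.one_apply]
    rw [hdet, hone, Matrix.det_one]
  · rw [Wirtinger.wirtingerDzPow_eq]
    exact hhol.iter_eq_zero (by rwa [Wirtinger.length_expand])
  · rw [Wirtinger.wirtingerDzbarPow_eq]
    exact hanti.iter_eq_zero (by rwa [Wirtinger.length_expand])
end

section
/- Define the extended Wick algebra 𝒲⁺ over ℂⁿ as the set of families of complex coefficients (c_{k,α,β}), indexed by k ∈ ℤ and multi-indices α, β ∈ ℕⁿ (thought of as formal sums ∑ c_{k,α,β} ℏᵏ z^α z̄^β), satisfying: (i) c_{k,α,β} = 0 unless the total degree 2k + |α| + |β| is ≥ 0, and (ii) for each integer d ≥ 0 there are only finitely many triples (k, α, β) with 2k + |α| + |β| = d and c_{k,α,β} ≠ 0. Then the Wick product formula f ⋆ g = ∑_{m≥0} ((−ℏ)ᵐ/m!) ∑_{i₁,…,i_m} (∂ᵐf/∂z^{i₁}⋯∂z^{i_m})·(∂ᵐg/∂z̄^{i₁}⋯∂z̄^{i_m}),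 extended formally, is well defined on 𝒲⁺: each coefficient of f ⋆ g is a finite sum, f ⋆ g again satisfies (i) and (ii), and the resulting product on 𝒲⁺ is associative. In other words, 𝒲⁺ is closed under the Wick product and is an associative ℂ-algebra. -/
/-- Index of a formal monomial `ℏᵏ z^α z̄^β`: `(k, α, β)` with `k ∈ ℤ` and
multi-indices `α, β ∈ ℕⁿ`. An element of the extended Wick algebra `𝒲⁺` is (the
coefficient family of) a formal sum `∑ c_{k,α,β} ℏᵏ z^α z̄^β`. -/
abbrev WickIdx (n : ℕ) := ℤ × (Fin n → ℕ) × (Fin n → ℕ)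

/-- The total degree `2k + |α| + |β|` of the monomial `ℏᵏ z^α z̄^β`. -/
def totalDeg {n : ℕ} (t : WickIdx n) : ℤ :=
  2 * t.1 + (∑ i, t.2.1 i : ℕ) + (∑ i, t.2.2 i : ℕ)

/-- Membership in the extended Wick algebra `𝒲⁺`: every nonzero coefficient has
nonnegative total degree, and for each degree `d` only finitely many coefficients of
total degree `d` are nonzero. -/
def MemWickPlus {n : ℕ} (c : WickIdx n → ℂ) : Prop :=
  (∀ t : WickIdx n, c t ≠ 0 → 0 ≤ totalDeg t) ∧
  ∀ d : ℤ, {t : WickIdx n | c t ≠ 0 ∧ totalDeg t = d}.Finite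

open Classical in
/-- The summand of the Wick-product coefficient of `f ⋆ g` at the monomial
`t = (k, α, β)`, indexed by the contraction multi-index `γ` (so that
`m = |γ|` derivatives are taken, with multiplicity `m!/γ!` accounting for the sum over
ordered tuples `i₁,…,i_m`, giving the factor `(−1)^{|γ|}/γ!`), the ℏ-degree `k₁` of the
factor from `f`, and the splittings `α = α₁ + α₂`, `β = β₁ + β₂`. -/
noncomputable def wickTerm {n : ℕ} (f g : WickIdx n → ℂ) (t : WickIdx n)
    (q : (Fin n → ℕ) × ℤ × (Fin n → ℕ) × (Fin n → ℕ)) : ℂ :=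
  if (∀ i, q.2.2.1 i ≤ t.2.1 i) ∧ (∀ i, q.2.2.2 i ≤ t.2.2 i) then
    ((-1 : ℂ) ^ (∑ i, q.1 i) / ∏ i, ((q.1 i).factorial : ℂ)) *
      (f (q.2.1, q.2.2.1 + q.1, q.2.2.2) *
        ∏ i, (((q.2.2.1 i + q.1 i).factorial : ℂ) / ((q.2.2.1 i).factorial : ℂ))) *
      (g (t.1 - q.2.1 - (∑ i, q.1 i : ℕ), t.2.1 - q.2.2.1, (t.2.2 - q.2.2.2) + q.1) *
        ∏ i, (((t.2.2 i - q.2.2.2 i + q.1 i).factorial : ℂ) /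
          ((t.2.2 i - q.2.2.2 i).factorial : ℂ)))
  else 0

/-- The Wick product on coefficient families, computed coefficientwise; each coefficient
of `f ⋆ g` is the (finite, by the theorem below) sum of `wickTerm`s. -/
noncomputable def wickMul {n : ℕ} (f g : WickIdx n → ℂ) : WickIdx n → ℂ :=
  fun t => ∑ᶠ q : (Fin n → ℕ) × ℤ × (Fin n → ℕ) × (Fin n → ℕ), wickTerm f g t q


lemma factorial_add_mul_choose (a m k : ℕ) :
    (m + k).factorial * a.choose (m + k) =
      (m.factorial * a.choose m) * (k.factorial * (a - m).choose k) := by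
  have h := Nat.descFactorial_mul_descFactorial (n := a) (Nat.le_add_right m k)
  rw [Nat.add_sub_cancel_left] at h
  rw [← Nat.descFactorial_eq_factorial_mul_choose, ← Nat.descFactorial_eq_factorial_mul_choose,
    ← Nat.descFactorial_eq_factorial_mul_choose, ← h, mul_comm]

/-- The coefficient of the `γ`-fold contraction of `z^a` with `z̄^b` in one variable. -/
noncomputable def contractCoeff (γ a b : ℕ) : ℂ :=
  (-1) ^ γ * ((γ.factorial * a.choose γ * b.choose γ : ℕ) : ℂ)

lemma contractCoeff_eq_zero {γ a b : ℕ} (h : ¬ (γ ≤ a ∧ γ ≤ b)) : contractCoeff γ a b = 0 := by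
  rcases not_and_or.mp h with h | h <;>
    simp [contractCoeff, Nat.choose_eq_zero_of_lt (not_le.mp h)]

open Finset in
lemma sum_antidiagonal_contract (a₁ a₂ b₂ b₃ N : ℕ) :
    ∑ p ∈ antidiagonal N, (p.1.factorial * a₁.choose p.1 * b₂.choose p.1) *
        (p.2.factorial * (a₁ - p.1 + a₂).choose p.2 * b₃.choose p.2) =
      ∑ p ∈ antidiagonal N, (p.1.factorial * a₂.choose p.1 * b₃.choose p.1) *
        (p.2.factorial * a₁.choose p.2 * (b₂ + (b₃ - p.1)).choose p.2) := by
  simp only [Nat.add_choose_eq, mul_sum, sum_mul]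
  rw [sum_sigma', sum_sigma']
  refine sum_nbij' (fun x => ⟨(x.2.2, x.1.1 + x.2.1), (x.1.1, x.2.1)⟩)
    (fun x => ⟨(x.2.1, x.2.2 + x.1.1), (x.2.2, x.1.1)⟩) ?_ ?_ ?_ ?_ ?_
  · rintro ⟨⟨γ, δ⟩, ⟨i, j⟩⟩ h
    simp only [mem_sigma, HasAntidiagonal.mem_antidiagonal] at h ⊢
    exact ⟨by omega, trivial⟩
  · rintro ⟨⟨γ, δ⟩, ⟨i, j⟩⟩ h
    simp only [mem_sigma, HasAntidiagonal.mem_antidiagonal] at h ⊢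
    exact ⟨by omega, trivial⟩
  · rintro ⟨⟨γ, δ⟩, ⟨i, j⟩⟩ h
    simp only [mem_sigma, HasAntidiagonal.mem_antidiagonal] at h
    obtain ⟨-, rfl⟩ := h
    rfl
  · rintro ⟨⟨γ, δ⟩, ⟨i, j⟩⟩ h
    simp only [mem_sigma, HasAntidiagonal.mem_antidiagonal] at h
    obtain ⟨-, rfl⟩ := h
    rfl
  · rintro ⟨⟨γ, δ⟩, ⟨i, j⟩⟩ h
    simp only [mem_sigma, HasAntidiagonal.mem_antidiagonal] at h
    obtain ⟨-, rfl⟩ := h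
    have h₁ := factorial_add_mul_choose b₃ j i
    have h₂ := factorial_add_mul_choose a₁ γ i
    rw [add_comm j i] at h₁
    dsimp only
    calc _ = (γ.factorial * a₁.choose γ * b₂.choose γ) * ((a₁ - γ).choose i * a₂.choose j) *
          ((i + j).factorial * b₃.choose (i + j)) := by ring
      _ = (j.factorial * a₂.choose j * b₃.choose j) * (b₂.choose γ * (b₃ - j).choose i) *
          ((γ + i).factorial * a₁.choose (γ + i)) := by rw [h₁, h₂]; ring
      _ = _ := by ring

open Finset in
lemma sum_range_contractCoeff (a₁ a₂ b₂ b₃ N : ℕ) :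
    ∑ γ ∈ Iic N, contractCoeff γ a₁ b₂ * contractCoeff (N - γ) (a₁ - γ + a₂) b₃ =
      ∑ γ ∈ Iic N, contractCoeff γ a₂ b₃ * contractCoeff (N - γ) a₁ (b₂ + (b₃ - γ)) := by
  have key := sum_antidiagonal_contract a₁ a₂ b₂ b₃ N
  rw [Nat.sum_antidiagonal_eq_sum_range_succ_mk, Nat.sum_antidiagonal_eq_sum_range_succ_mk,
    Nat.range_succ_eq_Iic] at key
  have sign : ∀ γ ∈ Iic N, ∀ x y : ℕ,
      ((-1 : ℂ) ^ γ * x) * ((-1) ^ (N - γ) * y) = (-1) ^ N * ((x * y : ℕ) : ℂ) := by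
    intro γ h x y
    rw [← Nat.add_sub_cancel' (mem_Iic.mp h), pow_add, Nat.add_sub_cancel_left]
    push_cast
    ring
  simp only [contractCoeff]
  rw [sum_congr rfl fun γ h => sign γ h _ _, sum_congr rfl fun γ h => sign γ h _ _, ← mul_sum,
    ← mul_sum, ← Nat.cast_sum, ← Nat.cast_sum, key]

section Monomials

open Finset

variable {n : ℕ}

/-- The coefficient of the contraction of `z^a` with `z̄^b` along the multi-index `γ`. -/
noncomputable def multiCoeff (γ a b : Fin n → ℕ) : ℂ :=
  ∏ i, contractCoeff (γ i) (a i) (b i)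

lemma multiCoeff_eq_zero {γ a b : Fin n → ℕ} (h : ¬ (γ ≤ a ∧ γ ≤ b)) :
    multiCoeff γ a b = 0 := by
  have : ∃ i, ¬ (γ i ≤ a i ∧ γ i ≤ b i) := by
    by_contra! h'
    exact h ⟨fun i => (h' i).1, fun i => (h' i).2⟩
  obtain ⟨i, hi⟩ := this
  exact prod_eq_zero (mem_univ i) (contractCoeff_eq_zero hi)

lemma Iic_eq_piFinset (N : Fin n → ℕ) : Iic N = Fintype.piFinset fun i => Iic (N i) := by
  ext γ
  simp [Pi.le_def]

lemma sum_Iic_multiCoeff (a₁ a₂ b₂ b₃ N : Fin n → ℕ) :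
    ∑ γ ∈ Iic N, multiCoeff γ a₁ b₂ * multiCoeff (N - γ) (a₁ - γ + a₂) b₃ =
      ∑ γ ∈ Iic N, multiCoeff γ a₂ b₃ * multiCoeff (N - γ) a₁ (b₂ + (b₃ - γ)) := by
  simp only [multiCoeff, ← prod_mul_distrib, Iic_eq_piFinset, Pi.sub_apply, Pi.add_apply]
  have h₁ := prod_univ_sum (fun i => Iic (N i)) fun i γ =>
    contractCoeff γ (a₁ i) (b₂ i) * contractCoeff (N i - γ) (a₁ i - γ + a₂ i) (b₃ i)
  have h₂ := prod_univ_sum (fun i => Iic (N i)) fun i γ =>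
    contractCoeff γ (a₂ i) (b₃ i) * contractCoeff (N i - γ) (a₁ i) (b₂ i + (b₃ i - γ))
  rw [← h₁, ← h₂]
  exact prod_congr rfl fun i _ => sum_range_contractCoeff _ _ _ _ _

/-- The index of the `γ`-contraction of two monomials. -/
def contractIdx (s₁ s₂ : WickIdx n) (γ : Fin n → ℕ) : WickIdx n :=
  (s₁.1 + s₂.1 + (∑ i, γ i : ℕ), s₁.2.1 - γ + s₂.2.1, s₁.2.2 + (s₂.2.2 - γ))

/-- The Wick product of two monomials. -/
noncomputable def monomialMul (s₁ s₂ : WickIdx n) : WickIdx n →₀ ℂ :=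
  ∑ γ ∈ Iic s₁.2.1, Finsupp.single (contractIdx s₁ s₂ γ) (multiCoeff γ s₁.2.1 s₂.2.2)

lemma monomialMul_eq_sum_Iic (s₁ s₂ : WickIdx n) {B : Fin n → ℕ} (hB : s₁.2.1 ≤ B) :
    monomialMul s₁ s₂ =
      ∑ γ ∈ Iic B, Finsupp.single (contractIdx s₁ s₂ γ) (multiCoeff γ s₁.2.1 s₂.2.2) := by
  refine sum_subset (Iic_subset_Iic.mpr hB) fun γ _ h => ?_
  rw [multiCoeff_eq_zero fun h' => h (mem_Iic.mpr h'.1), Finsupp.single_zero]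

/-- The Wick product on finitely supported coefficient families, as a bilinear map. -/
noncomputable def finWickMul :
    (WickIdx n →₀ ℂ) →ₗ[ℂ] (WickIdx n →₀ ℂ) →ₗ[ℂ] (WickIdx n →₀ ℂ) :=
  Finsupp.linearCombination ℂ fun s₁ => Finsupp.linearCombination ℂ (monomialMul s₁)

lemma finWickMul_single (s₁ s₂ : WickIdx n) (x y : ℂ) :
    finWickMul (Finsupp.single s₁ x) (Finsupp.single s₂ y) = (x * y) • monomialMul s₁ s₂ := by
  simp [finWickMul, Finsupp.linearCombination_single, smul_smul]

lemma sum_sum_Iic_eq_of_add_le {M : Type*} [AddCommMonoid M] (B : Fin n → ℕ)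
    (G : (Fin n → ℕ) → (Fin n → ℕ) → M) (hG : ∀ γ δ, G γ δ ≠ 0 → γ + δ ≤ B) :
    ∑ γ ∈ Iic B, ∑ δ ∈ Iic B, G γ δ = ∑ N ∈ Iic B, ∑ γ ∈ Iic N, G γ (N - γ) := by
  rw [sum_sigma', sum_sigma']
  refine sum_bij_ne_zero (fun x _ _ => ⟨x.1 + x.2, x.1⟩) ?_ ?_ ?_ ?_
  · rintro ⟨γ, δ⟩ - h
    simpa using hG γ δ h
  · rintro ⟨γ, δ⟩ - - ⟨γ', δ'⟩ - - h
    simp only [Sigma.mk.injEq, heq_eq_eq] at h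
    obtain ⟨h, rfl⟩ := h
    simpa using h
  · rintro ⟨N, γ⟩ h hne
    simp only [mem_sigma, mem_Iic] at h
    refine ⟨⟨γ, N - γ⟩, ?_, hne, ?_⟩
    · simp only [mem_sigma, mem_Iic]
      exact ⟨h.2.trans h.1, tsub_le_self.trans h.1⟩
    · simp [add_tsub_cancel_of_le h.2]
  · rintro ⟨γ, δ⟩ - -
    simp

/-- The index of a triple product of monomials with `|N|` contractions in total. -/
def contractIdx₃ (s₁ s₂ s₃ : WickIdx n) (N : Fin n → ℕ) : WickIdx n :=
  (s₁.1 + s₂.1 + s₃.1 + (∑ i, N i : ℕ), s₁.2.1 + s₂.2.1 + s₃.2.1 - N,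
    s₁.2.2 + s₂.2.2 + s₃.2.2 - N)

lemma finWickMul_monomialMul_single (s₁ s₂ s₃ : WickIdx n) :
    finWickMul (monomialMul s₁ s₂) (Finsupp.single s₃ 1) =
      ∑ N ∈ Iic (s₁.2.1 + s₂.2.1), Finsupp.single (contractIdx₃ s₁ s₂ s₃ N)
        (∑ γ ∈ Iic N, multiCoeff γ s₁.2.1 s₂.2.2 *
          multiCoeff (N - γ) (s₁.2.1 - γ + s₂.2.1) s₃.2.2) := by
  have hexp : finWickMul (monomialMul s₁ s₂) (Finsupp.single s₃ 1) =
      ∑ γ ∈ Iic (s₁.2.1 + s₂.2.1), ∑ δ ∈ Iic (s₁.2.1 + s₂.2.1),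
        Finsupp.single (contractIdx₃ s₁ s₂ s₃ (γ + δ))
          (multiCoeff γ s₁.2.1 s₂.2.2 * multiCoeff δ (s₁.2.1 - γ + s₂.2.1) s₃.2.2) := by
    rw [monomialMul_eq_sum_Iic s₁ s₂ (le_self_add : s₁.2.1 ≤ s₁.2.1 + s₂.2.1), map_sum,
      LinearMap.sum_apply]
    refine sum_congr rfl fun γ _ => ?_
    rw [finWickMul_single, monomialMul_eq_sum_Iic (contractIdx s₁ s₂ γ) s₃
      (show s₁.2.1 - γ + s₂.2.1 ≤ s₁.2.1 + s₂.2.1 from add_le_add_left tsub_le_self _), smul_sum]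
    refine sum_congr rfl fun δ _ => ?_
    rw [Finsupp.smul_single, smul_eq_mul, mul_one]
    by_cases h₁ : γ ≤ s₁.2.1 ∧ γ ≤ s₂.2.2
    · by_cases h₂ : δ ≤ s₁.2.1 - γ + s₂.2.1 ∧ δ ≤ s₃.2.2
      · congr 1
        ext i
        · simp only [contractIdx, contractIdx₃, Pi.add_apply, sum_add_distrib]
          push_cast
          ring
        all_goals
          have := h₁.1 i
          have := h₁.2 i
          have := h₂.1 i
          have := h₂.2 i
          simp only [contractIdx, contractIdx₃, Pi.add_apply, Pi.sub_apply] at *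
          omega
      · simp [contractIdx, multiCoeff_eq_zero h₂]
    · simp [multiCoeff_eq_zero h₁]
  rw [hexp, sum_sum_Iic_eq_of_add_le]
  · refine sum_congr rfl fun N _ => ?_
    rw [Finsupp.single_finsetSum]
    exact sum_congr rfl fun γ h => by rw [add_tsub_cancel_of_le (mem_Iic.mp h)]
  · intro γ δ h
    by_contra hle
    apply h
    by_cases h₁ : γ ≤ s₁.2.1 ∧ γ ≤ s₂.2.2
    · have h₂ : ¬ (δ ≤ s₁.2.1 - γ + s₂.2.1 ∧ δ ≤ s₃.2.2) := by
        refine fun h₂ => hle fun i => ?_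
        have := h₁.1 i
        have := h₂.1 i
        simp only [Pi.add_apply, Pi.sub_apply] at *
        omega
      simp [multiCoeff_eq_zero h₂]
    · simp [multiCoeff_eq_zero h₁]

lemma finWickMul_single_monomialMul (s₁ s₂ s₃ : WickIdx n) :
    finWickMul (Finsupp.single s₁ 1) (monomialMul s₂ s₃) =
      ∑ N ∈ Iic (s₁.2.1 + s₂.2.1), Finsupp.single (contractIdx₃ s₁ s₂ s₃ N)
        (∑ γ ∈ Iic N, multiCoeff γ s₂.2.1 s₃.2.2 *
          multiCoeff (N - γ) s₁.2.1 (s₂.2.2 + (s₃.2.2 - γ))) := by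
  have hexp : finWickMul (Finsupp.single s₁ 1) (monomialMul s₂ s₃) =
      ∑ γ ∈ Iic (s₁.2.1 + s₂.2.1), ∑ δ ∈ Iic (s₁.2.1 + s₂.2.1),
        Finsupp.single (contractIdx₃ s₁ s₂ s₃ (γ + δ))
          (multiCoeff γ s₂.2.1 s₃.2.2 * multiCoeff δ s₁.2.1 (s₂.2.2 + (s₃.2.2 - γ))) := by
    rw [monomialMul_eq_sum_Iic s₂ s₃ (le_add_self : s₂.2.1 ≤ s₁.2.1 + s₂.2.1), map_sum]
    refine sum_congr rfl fun γ _ => ?_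
    rw [finWickMul_single, monomialMul_eq_sum_Iic s₁ (contractIdx s₂ s₃ γ)
      (le_self_add : s₁.2.1 ≤ s₁.2.1 + s₂.2.1), smul_sum]
    refine sum_congr rfl fun δ _ => ?_
    rw [Finsupp.smul_single, smul_eq_mul, one_mul]
    by_cases h₁ : γ ≤ s₂.2.1 ∧ γ ≤ s₃.2.2
    · by_cases h₂ : δ ≤ s₁.2.1 ∧ δ ≤ s₂.2.2 + (s₃.2.2 - γ)
      · congr 1
        ext i
        · simp only [contractIdx, contractIdx₃, Pi.add_apply, sum_add_distrib]
          push_cast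
          ring
        all_goals
          have := h₁.1 i
          have := h₁.2 i
          have := h₂.1 i
          have := h₂.2 i
          simp only [contractIdx, contractIdx₃, Pi.add_apply, Pi.sub_apply] at *
          omega
      · simp [contractIdx, multiCoeff_eq_zero h₂]
    · simp [multiCoeff_eq_zero h₁]
  rw [hexp, sum_sum_Iic_eq_of_add_le]
  · refine sum_congr rfl fun N _ => ?_
    rw [Finsupp.single_finsetSum]
    exact sum_congr rfl fun γ h => by rw [add_tsub_cancel_of_le (mem_Iic.mp h)]
  · intro γ δ h
    by_contra hle
    apply h
    by_cases h₁ : γ ≤ s₂.2.1 ∧ γ ≤ s₃.2.2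
    · have h₂ : ¬ (δ ≤ s₁.2.1 ∧ δ ≤ s₂.2.2 + (s₃.2.2 - γ)) :=
        fun h₂ => hle ((add_le_add h₁.1 h₂.1).trans_eq (add_comm _ _))
      simp [multiCoeff_eq_zero h₂]
    · simp [multiCoeff_eq_zero h₁]

lemma finWickMul_assoc (f g h : WickIdx n →₀ ℂ) :
    finWickMul (finWickMul f g) h = finWickMul f (finWickMul g h) := by
  induction f using Finsupp.induction_linear with
  | zero => simp
  | add f₁ f₂ h₁ h₂ => simp only [map_add, LinearMap.add_apply, h₁, h₂]
  | single s₁ x =>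
  induction g using Finsupp.induction_linear with
  | zero => simp
  | add f₁ f₂ h₁ h₂ => simp only [map_add, LinearMap.add_apply, h₁, h₂]
  | single s₂ y =>
  induction h using Finsupp.induction_linear with
  | zero => simp
  | add f₁ f₂ h₁ h₂ => simp only [map_add, h₁, h₂]
  | single s₃ w =>
  have h₁ : Finsupp.single s₁ x = x • Finsupp.single s₁ (1 : ℂ) := by simp
  have h₃ : Finsupp.single s₃ w = w • Finsupp.single s₃ (1 : ℂ) := by simp
  rw [finWickMul_single, finWickMul_single, h₁, h₃]
  simp only [map_smul, LinearMap.smul_apply, finWickMul_monomialMul_single,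
    finWickMul_single_monomialMul, sum_Iic_multiCoeff, smul_smul]
  congr 1
  ring

lemma totalDeg_contractIdx {s₁ s₂ : WickIdx n} {γ : Fin n → ℕ} (h₁ : γ ≤ s₁.2.1)
    (h₂ : γ ≤ s₂.2.2) : totalDeg (contractIdx s₁ s₂ γ) = totalDeg s₁ + totalDeg s₂ := by
  have e₁ : ∑ i, (s₁.2.1 - γ) i + ∑ i, γ i = ∑ i, s₁.2.1 i := by
    rw [← sum_add_distrib]
    exact sum_congr rfl fun i _ => Nat.sub_add_cancel (h₁ i)
  have e₂ : ∑ i, (s₂.2.2 - γ) i + ∑ i, γ i = ∑ i, s₂.2.2 i := by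
    rw [← sum_add_distrib]
    exact sum_congr rfl fun i _ => Nat.sub_add_cancel (h₂ i)
  simp only [totalDeg, contractIdx, Pi.add_apply, sum_add_distrib, ← e₁, ← e₂]
  push_cast
  ring

lemma contractIdx_right_injective {s₁ s₂ s₃ : WickIdx n} {γ : Fin n → ℕ} (h₂ : γ ≤ s₂.2.2)
    (h₃ : γ ≤ s₃.2.2) (h : contractIdx s₁ s₂ γ = contractIdx s₁ s₃ γ) : s₂ = s₃ := by
  simp only [contractIdx, Prod.mk.injEq, add_left_inj, add_right_inj] at h
  refine Prod.ext h.1 (Prod.ext h.2.1 ?_)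
  rw [← tsub_add_cancel_of_le h₂, h.2.2, tsub_add_cancel_of_le h₃]

/-- The summation index of `wickTerm` belonging to the `γ`-contraction of `s₁` with a second
monomial. -/
def termIdx (s₁ : WickIdx n) (γ : Fin n → ℕ) : (Fin n → ℕ) × ℤ × (Fin n → ℕ) × (Fin n → ℕ) :=
  (γ, s₁.1, s₁.2.1 - γ, s₁.2.2)

lemma contractCoeff_add_add (γ a b : ℕ) :
    contractCoeff γ (a + γ) (b + γ) =
      (-1) ^ γ / (γ.factorial : ℂ) * (((a + γ).factorial : ℂ) / (a.factorial : ℂ)) *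
        (((b + γ).factorial : ℂ) / (b.factorial : ℂ)) := by
  have h₁ := Nat.add_choose_mul_factorial_mul_factorial a γ
  have h₂ := Nat.add_choose_mul_factorial_mul_factorial b γ
  have hγ : (γ.factorial : ℂ) ≠ 0 := Nat.cast_ne_zero.mpr γ.factorial_ne_zero
  have ha : (a.factorial : ℂ) ≠ 0 := Nat.cast_ne_zero.mpr a.factorial_ne_zero
  have hb : (b.factorial : ℂ) ≠ 0 := Nat.cast_ne_zero.mpr b.factorial_ne_zero
  rw [contractCoeff, ← h₁, ← h₂]
  push_cast
  field_simp

lemma wickTerm_contractIdx (f g : WickIdx n → ℂ) {s₁ s₂ : WickIdx n} {γ : Fin n → ℕ}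
    (h₁ : γ ≤ s₁.2.1) (h₂ : γ ≤ s₂.2.2) :
    wickTerm f g (contractIdx s₁ s₂ γ) (termIdx s₁ γ) =
      f s₁ * g s₂ * multiCoeff γ s₁.2.1 s₂.2.2 := by
  obtain ⟨k₁, a₁, b₁⟩ := s₁
  obtain ⟨k₂, a₂, b₂⟩ := s₂
  dsimp only at h₁ h₂
  obtain ⟨a, rfl⟩ : ∃ a, a₁ = a + γ := ⟨_, (tsub_add_cancel_of_le h₁).symm⟩
  obtain ⟨b, rfl⟩ : ∃ b, b₂ = b + γ := ⟨_, (tsub_add_cancel_of_le h₂).symm⟩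
  have hk : k₁ + k₂ + ((∑ i, γ i : ℕ) : ℤ) - k₁ - ((∑ i, γ i : ℕ) : ℤ) = k₂ := by ring
  simp only [wickTerm, contractIdx, termIdx, add_tsub_cancel_right, add_tsub_cancel_left, hk,
    Pi.add_apply, le_add_iff_nonneg_right, zero_le, implies_true, and_self, if_true, multiCoeff,
    contractCoeff_add_add, prod_mul_distrib, prod_div_distrib, prod_pow_eq_pow_sum]
  ring

lemma exists_of_wickTerm_ne_zero {f g : WickIdx n → ℂ} {t : WickIdx n}
    {q : (Fin n → ℕ) × ℤ × (Fin n → ℕ) × (Fin n → ℕ)} (h : wickTerm f g t q ≠ 0) :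
    ∃ s₁ s₂ γ, γ ≤ s₁.2.1 ∧ γ ≤ s₂.2.2 ∧ f s₁ ≠ 0 ∧ g s₂ ≠ 0 ∧ t = contractIdx s₁ s₂ γ ∧
      q = termIdx s₁ γ := by
  obtain ⟨γ, k, a, b⟩ := q
  obtain ⟨l, a', b'⟩ := t
  rw [wickTerm] at h
  split_ifs at h with hle
  · refine ⟨(k, a + γ, b), (l - k - (∑ i, γ i : ℕ), a' - a, b' - b + γ), γ, le_add_self,
      le_add_self, left_ne_zero_of_mul (right_ne_zero_of_mul (left_ne_zero_of_mul h)),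
      left_ne_zero_of_mul (right_ne_zero_of_mul h), ?_, ?_⟩
    · simp only [contractIdx, add_tsub_cancel_right]
      rw [add_tsub_cancel_of_le (show a ≤ a' from hle.1),
        add_tsub_cancel_of_le (show b ≤ b' from hle.2)]
      congr 1
      ring
    · simp [termIdx]
  · exact absurd rfl h

/-- The summation indices that contribute to the product of two finitely supported families. -/
noncomputable def termIdxFinset (f g : WickIdx n →₀ ℂ) :
    Finset ((Fin n → ℕ) × ℤ × (Fin n → ℕ) × (Fin n → ℕ)) :=
  ((f.support ×ˢ g.support).sigma fun p => Iic p.1.2.1).image fun x => termIdx x.1.1 x.2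

lemma support_wickTerm_subset (f g : WickIdx n →₀ ℂ) (t : WickIdx n) :
    Function.support (wickTerm f g t) ⊆ termIdxFinset f g := by
  intro q hq
  obtain ⟨s₁, s₂, γ, h₁, h₂, hf, hg, -, rfl⟩ := exists_of_wickTerm_ne_zero hq
  refine mem_coe.mpr (mem_image.mpr ⟨⟨(s₁, s₂), γ⟩, ?_, rfl⟩)
  simp [hf, hg, h₁]

lemma finWickMul_apply (f g : WickIdx n →₀ ℂ) (t : WickIdx n) :
    finWickMul f g t = ∑ x ∈ (f.support ×ˢ g.support).sigma fun p => Iic p.1.2.1,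
      if contractIdx x.1.1 x.1.2 x.2 = t then
        f x.1.1 * g x.1.2 * multiCoeff x.2 x.1.1.2.1 x.1.2.2.2 else 0 := by
  classical
  rw [sum_sigma, sum_product, finWickMul, Finsupp.linearCombination_apply, Finsupp.sum,
    LinearMap.sum_apply, Finsupp.finsetSum_apply]
  refine sum_congr rfl fun s₁ _ => ?_
  rw [LinearMap.smul_apply, Finsupp.linearCombination_apply, Finsupp.sum, Finsupp.smul_apply,
    Finsupp.finsetSum_apply, smul_sum]
  refine sum_congr rfl fun s₂ _ => ?_
  rw [Finsupp.smul_apply, monomialMul, Finsupp.finsetSum_apply, smul_sum, smul_sum]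
  refine sum_congr rfl fun γ _ => ?_
  rw [Finsupp.single_apply]
  split_ifs <;> simp [mul_assoc]

lemma wickMul_eq_finWickMul (f g : WickIdx n →₀ ℂ) : wickMul f g = finWickMul f g := by
  ext t
  rw [wickMul, finsum_eq_sum_of_support_subset _ (support_wickTerm_subset f g t),
    finWickMul_apply]
  have key : ∀ x : Σ _ : WickIdx n × WickIdx n, Fin n → ℕ,
      (if contractIdx x.1.1 x.1.2 x.2 = t then
        f x.1.1 * g x.1.2 * multiCoeff x.2 x.1.1.2.1 x.1.2.2.2 else 0) ≠ 0 →
      contractIdx x.1.1 x.1.2 x.2 = t ∧ x.2 ≤ x.1.1.2.1 ∧ x.2 ≤ x.1.2.2.2 := by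
    intro x hx
    rw [ne_eq, ite_eq_right_iff, Classical.not_imp] at hx
    exact ⟨hx.1, by_contra fun h => hx.2 (by rw [multiCoeff_eq_zero h, mul_zero])⟩
  symm
  refine sum_bij_ne_zero (fun x _ _ => termIdx x.1.1 x.2) ?_ ?_ ?_ ?_
  · exact fun x hx _ => mem_image_of_mem (fun x : Σ _ : WickIdx n × WickIdx n, Fin n → ℕ =>
      termIdx x.1.1 x.2) hx
  · rintro ⟨⟨s₁, s₂⟩, γ⟩ - hx ⟨⟨s₁', s₂'⟩, γ'⟩ - hx' h
    obtain ⟨ht, h₁, h₂⟩ := key _ hx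
    obtain ⟨ht', h₁', h₂'⟩ := key _ hx'
    simp only [termIdx, Prod.mk.injEq] at h
    dsimp only at *
    obtain ⟨rfl, hk, ha, hb⟩ := h
    obtain rfl : s₁ = s₁' := by
      refine Prod.ext hk (Prod.ext ?_ hb)
      rw [← tsub_add_cancel_of_le h₁, ha, tsub_add_cancel_of_le h₁']
    rw [contractIdx_right_injective h₂ h₂' (ht.trans ht'.symm)]
  · intro q _ hq
    obtain ⟨s₁, s₂, γ, h₁, h₂, hf, hg, rfl, rfl⟩ := exists_of_wickTerm_ne_zero hq
    refine ⟨⟨(s₁, s₂), γ⟩, by simp [hf, hg, h₁], ?_, rfl⟩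
    rwa [if_pos rfl, ← wickTerm_contractIdx f g h₁ h₂]
  · intro x _ hx
    obtain ⟨ht, h₁, h₂⟩ := key x hx
    rw [if_pos ht, ← ht, wickTerm_contractIdx f g h₁ h₂]

end Monomials

section Truncation

variable {n : ℕ}

/-- `f` and `f'` are supported in nonnegative degrees and agree in degrees at most `d`. -/
structure AgreeUpTo (d : ℤ) (f f' : WickIdx n → ℂ) : Prop where
  nonneg_left : ∀ t, f t ≠ 0 → 0 ≤ totalDeg t
  nonneg_right : ∀ t, f' t ≠ 0 → 0 ≤ totalDeg t
  eq : ∀ t, totalDeg t ≤ d → f t = f' t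

lemma AgreeUpTo.symm {d : ℤ} {f f' : WickIdx n → ℂ} (h : AgreeUpTo d f f') :
    AgreeUpTo d f' f :=
  ⟨h.nonneg_right, h.nonneg_left, fun t ht => (h.eq t ht).symm⟩

lemma AgreeUpTo.wickTerm_eq_of_ne_zero {d : ℤ} {f f' g g' : WickIdx n → ℂ}
    (hf : AgreeUpTo d f f') (hg : AgreeUpTo d g g') {t : WickIdx n} (ht : totalDeg t ≤ d)
    {q : (Fin n → ℕ) × ℤ × (Fin n → ℕ) × (Fin n → ℕ)} (hq : wickTerm f g t q ≠ 0) :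
    wickTerm f g t q = wickTerm f' g' t q := by
  obtain ⟨s₁, s₂, γ, h₁, h₂, hf₀, hg₀, rfl, rfl⟩ := exists_of_wickTerm_ne_zero hq
  rw [totalDeg_contractIdx h₁ h₂] at ht
  have d₁ := hf.nonneg_left s₁ hf₀
  have d₂ := hg.nonneg_left s₂ hg₀
  rw [wickTerm_contractIdx f g h₁ h₂, wickTerm_contractIdx f' g' h₁ h₂, hf.eq s₁ (by linarith),
    hg.eq s₂ (by linarith)]

lemma AgreeUpTo.wickTerm_eq {d : ℤ} {f f' g g' : WickIdx n → ℂ} (hf : AgreeUpTo d f f')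
    (hg : AgreeUpTo d g g') {t : WickIdx n} (ht : totalDeg t ≤ d) :
    wickTerm f g t = wickTerm f' g' t := by
  ext q
  by_cases hq : wickTerm f g t q = 0
  · by_cases hq' : wickTerm f' g' t q = 0
    · rw [hq, hq']
    · exact (hf.symm.wickTerm_eq_of_ne_zero hg.symm ht hq').symm
  · exact hf.wickTerm_eq_of_ne_zero hg ht hq

lemma totalDeg_nonneg_of_wickMul_ne_zero {f g : WickIdx n → ℂ}
    (hf : ∀ t, f t ≠ 0 → 0 ≤ totalDeg t) (hg : ∀ t, g t ≠ 0 → 0 ≤ totalDeg t) (t : WickIdx n)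
    (ht : wickMul f g t ≠ 0) : 0 ≤ totalDeg t := by
  obtain ⟨q, hq⟩ : ∃ q, wickTerm f g t q ≠ 0 := by
    by_contra! h
    exact ht (by simp [wickMul, h])
  obtain ⟨s₁, s₂, γ, h₁, h₂, hf₀, hg₀, rfl, -⟩ := exists_of_wickTerm_ne_zero hq
  rw [totalDeg_contractIdx h₁ h₂]
  exact add_nonneg (hf s₁ hf₀) (hg s₂ hg₀)

lemma AgreeUpTo.wickMul {d : ℤ} {f f' g g' : WickIdx n → ℂ} (hf : AgreeUpTo d f f')
    (hg : AgreeUpTo d g g') : AgreeUpTo d (wickMul f g) (wickMul f' g') where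
  nonneg_left := totalDeg_nonneg_of_wickMul_ne_zero hf.nonneg_left hg.nonneg_left
  nonneg_right := totalDeg_nonneg_of_wickMul_ne_zero hf.nonneg_right hg.nonneg_right
  eq t ht := by simp only [_root_.wickMul, hf.wickTerm_eq hg ht]

lemma MemWickPlus.exists_agreeUpTo {f : WickIdx n → ℂ} (hf : MemWickPlus f) (d : ℤ) :
    ∃ f' : WickIdx n →₀ ℂ, AgreeUpTo d f f' := by
  classical
  have hfin : {t : WickIdx n | f t ≠ 0 ∧ totalDeg t ≤ d}.Finite := by
    refine ((Set.finite_Icc (0 : ℤ) d).biUnion fun e _ => hf.2 e).subset fun t ht => ?_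
    simp only [Set.mem_iUnion]
    exact ⟨totalDeg t, ⟨hf.1 t ht.1, ht.2⟩, ht.1, rfl⟩
  refine ⟨Finsupp.onFinset hfin.toFinset (fun t => if totalDeg t ≤ d then f t else 0) ?_,
    hf.1, ?_, ?_⟩
  · intro t ht
    rw [ne_eq, ite_eq_right_iff, Classical.not_imp] at ht
    exact hfin.mem_toFinset.mpr ⟨ht.2, ht.1⟩
  · intro t ht
    rw [Finsupp.onFinset_apply, ne_eq, ite_eq_right_iff, Classical.not_imp] at ht
    exact hf.1 t ht.2
  · intro t ht
    rw [Finsupp.onFinset_apply, if_pos ht]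

end Truncation

/-- The extended Wick algebra `𝒲⁺` is closed under the Wick product: for `f, g ∈ 𝒲⁺`
each coefficient of `f ⋆ g` is a finite sum, `f ⋆ g ∈ 𝒲⁺` again, and the Wick product
is associative on `𝒲⁺`. -/
theorem wickPlus_closed_and_assoc (n : ℕ) (f g : WickIdx n → ℂ)
    (hf : MemWickPlus f) (hg : MemWickPlus g) :
    (∀ t : WickIdx n, (Function.support (wickTerm f g t)).Finite) ∧
    MemWickPlus (wickMul f g) ∧
    (∀ h : WickIdx n → ℂ, MemWickPlus h →
      wickMul (wickMul f g) h = wickMul f (wickMul g h)) := by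
  refine ⟨fun t => ?_, ⟨totalDeg_nonneg_of_wickMul_ne_zero hf.1 hg.1, fun d => ?_⟩, fun h hh => ?_⟩
  · obtain ⟨f', hf'⟩ := hf.exists_agreeUpTo (totalDeg t)
    obtain ⟨g', hg'⟩ := hg.exists_agreeUpTo (totalDeg t)
    rw [hf'.wickTerm_eq hg' le_rfl]
    exact (Finset.finite_toSet _).subset (support_wickTerm_subset f' g' t)
  · obtain ⟨f', hf'⟩ := hf.exists_agreeUpTo d
    obtain ⟨g', hg'⟩ := hg.exists_agreeUpTo d
    refine (finWickMul f' g').support.finite_toSet.subset fun t ht => ?_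
    rw [Finset.mem_coe, Finsupp.mem_support_iff, ← wickMul_eq_finWickMul,
      ← (hf'.wickMul hg').eq t ht.2.le]
    exact ht.1
  · ext t
    obtain ⟨f', hf'⟩ := hf.exists_agreeUpTo (totalDeg t)
    obtain ⟨g', hg'⟩ := hg.exists_agreeUpTo (totalDeg t)
    obtain ⟨h', hh'⟩ := hh.exists_agreeUpTo (totalDeg t)
    rw [((hf'.wickMul hg').wickMul hh').eq t le_rfl, (hf'.wickMul (hg'.wickMul hh')).eq t le_rfl]
    simp only [wickMul_eq_finWickMul, finWickMul_assoc]
end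

section
/- Let 𝒲 = ℂ[[z¹,…,zⁿ, z̄¹,…,z̄ⁿ]][[ℏ]] with the Wick product (which is well defined coefficientwise on 𝒲), and let 𝒲⁺ be the extended Wick algebra, which contains 𝒲. Let φ ∈ 𝒲 be such that every monomial ℏᵏ z^α z̄^β occurring in φ with nonzero coefficient has total degree 2k + |α| + |β| ≥ 3. Then: (i) the exponential e^{φ/ℏ} := ∑_{m≥0} φᵐ/(m!·ℏᵐ) is a well-defined element of 𝒲⁺ (for each fixed monomial ℏᵏ z^α z̄^β only finitely many m contribute to its coefficient); and (ii) e^{φ/ℏ} is invertible in 𝒲⁺ with respect to the Wick product ⋆, i.e. there exists a (unique) element (e^{φ/ℏ})^{−1} ∈ 𝒲⁺ with e^{φ/ℏ} ⋆ (e^{φ/ℏ})^{−1} = (e^{φ/ℏ})^{−1} ⋆ e^{φ/ℏ} = 1. -/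
open Classical in
/-- The commutative product of formal sums, computed coefficientwise. -/
noncomputable def cMul {n : ℕ} (f g : WickIdx n → ℂ) : WickIdx n → ℂ := fun t =>
  ∑ᶠ q : ℤ × (Fin n → ℕ) × (Fin n → ℕ),
    if (∀ i, q.2.1 i ≤ t.2.1 i) ∧ (∀ i, q.2.2 i ≤ t.2.2 i) then
      f q * g (t.1 - q.1, t.2.1 - q.2.1, t.2.2 - q.2.2)
    else 0

open Classical in
/-- The constant `1` as a formal sum. -/
noncomputable def cOne {n : ℕ} : WickIdx n → ℂ := fun t =>
  if t = ((0 : ℤ), (0 : Fin n → ℕ), (0 : Fin n → ℕ)) then 1 else 0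

/-- Commutative powers `φᵐ` of a formal sum. -/
noncomputable def cPow {n : ℕ} (φ : WickIdx n → ℂ) : ℕ → WickIdx n → ℂ
  | 0 => cOne
  | m + 1 => cMul φ (cPow φ m)

/-- The summand `φᵐ/(m!·ℏᵐ)` of `e^{φ/ℏ}` contributing to the coefficient of the
monomial `t = (k, α, β)`: the coefficient of `ℏ^{k+m} z^α z̄^β` in `φᵐ/m!`. -/
noncomputable def expTerm {n : ℕ} (φ : WickIdx n → ℂ) (t : WickIdx n) (m : ℕ) : ℂ :=
  ((m.factorial : ℂ))⁻¹ * cPow φ m (t.1 + m, t.2.1, t.2.2)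

/-- The exponential `e^{φ/ℏ} = ∑_m φᵐ/(m!·ℏᵐ)`, computed coefficientwise. -/
noncomputable def wickExp {n : ℕ} (φ : WickIdx n → ℂ) : WickIdx n → ℂ :=
  fun t => ∑ᶠ m : ℕ, expTerm φ t m

namespace Wick

open Finset

variable {n : ℕ}

/-- The finite formal sums of monomials. -/
abbrev FinSum (n : ℕ) := WickIdx n →₀ ℂ

/-- Laurent polynomials in `ℏ` with coefficients polynomial in `z̄`. -/
abbrev Fock (n : ℕ) := (ℤ × (Fin n → ℕ)) →₀ ℂ

/-- The action of `ℏᵏ z^α z̄^β` on Fock space as the operator `ℏᵏ z̄^β (-ℏ ∂_{z̄})^α`. -/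
noncomputable def monomialOp (a : WickIdx n) : Module.End ℂ (Fock n) :=
  Finsupp.linearCombination ℂ fun p : ℤ × (Fin n → ℕ) =>
    Finsupp.single (p.1 + a.1 + (∑ i, a.2.1 i : ℕ), p.2 - a.2.1 + a.2.2)
      ((-1 : ℂ) ^ (∑ i, a.2.1 i) * ∏ i, ((p.2 i).descFactorial (a.2.1 i) : ℂ))

/-- The Fock representation of finite formal sums. -/
noncomputable def fockRep : FinSum n →ₗ[ℂ] Module.End ℂ (Fock n) :=
  Finsupp.linearCombination ℂ monomialOp

/-- The coefficient of the `μ`-th term in the Wick product of two monomials. -/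
noncomputable def monomialCoeff (a b : WickIdx n) (μ : Fin n → ℕ) : ℂ :=
  (-1 : ℂ) ^ (∑ i, μ i) *
    ∏ i, (((a.2.1 i).choose (μ i) : ℂ) * ((b.2.2 i).descFactorial (μ i) : ℂ))

/-- The monomial of the `μ`-th term in the Wick product of two monomials. -/
def monomialIdx (a b : WickIdx n) (μ : Fin n → ℕ) : WickIdx n :=
  (a.1 + b.1 + (∑ i, μ i : ℕ), a.2.1 + b.2.1 - μ, a.2.2 + b.2.2 - μ)

/-- The Wick product of two monomials. -/
noncomputable def monomialMul (a b : WickIdx n) : FinSum n :=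
  ∑ μ ∈ Fintype.piFinset (fun i => range (a.2.1 i + 1)),
    Finsupp.single (monomialIdx a b μ) (monomialCoeff a b μ)

/-- The Wick product of finite formal sums. -/
noncomputable def finMul : FinSum n →ₗ[ℂ] FinSum n →ₗ[ℂ] FinSum n :=
  Finsupp.linearCombination ℂ fun a => Finsupp.linearCombination ℂ (monomialMul a)

/-- Vandermonde's identity for falling factorials. -/
lemma add_descFactorial_eq (x y a : ℕ) :
    (x + y).descFactorial a =
      ∑ m ∈ range (a + 1), a.choose m * y.descFactorial m * x.descFactorial (a - m) := by
  rw [Nat.descFactorial_eq_factorial_mul_choose, add_comm x y, Nat.add_choose_eq,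
    Nat.sum_antidiagonal_eq_sum_range_succ (fun i j => y.choose i * x.choose j), mul_sum]
  refine sum_congr rfl fun m hm => ?_
  have hm : m ≤ a := by simpa [Nat.lt_succ_iff] using hm
  rw [Nat.descFactorial_eq_factorial_mul_choose y, Nat.descFactorial_eq_factorial_mul_choose x,
    ← Nat.choose_mul_factorial_mul_factorial hm]
  ring

lemma descFactorial_mul_descFactorial_eq (g a₁ a₂ b₂ : ℕ) :
    g.descFactorial a₂ * (g - a₂ + b₂).descFactorial a₁ =
      ∑ m ∈ range (a₁ + 1),
        a₁.choose m * b₂.descFactorial m * g.descFactorial (a₁ + a₂ - m) := by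
  rw [add_descFactorial_eq, mul_sum]
  refine sum_congr rfl fun m hm => ?_
  have hm : m ≤ a₁ := by simpa [Nat.lt_succ_iff] using hm
  rw [show a₁ + a₂ - m = (a₁ - m) + a₂ by omega,
    ← Nat.descFactorial_mul_descFactorial (n := g) (k := a₂) (m := a₁ - m + a₂) (by omega),
    Nat.add_sub_cancel]
  ring

lemma monomialOp_single (a : WickIdx n) (p : ℤ × (Fin n → ℕ)) (x : ℂ) :
    monomialOp a (Finsupp.single p x) =
      Finsupp.single (p.1 + a.1 + (∑ i, a.2.1 i : ℕ), p.2 - a.2.1 + a.2.2)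
        (x * ((-1 : ℂ) ^ (∑ i, a.2.1 i) * ∏ i, ((p.2 i).descFactorial (a.2.1 i) : ℂ))) := by
  rw [monomialOp, Finsupp.linearCombination_single, Finsupp.smul_single, smul_eq_mul]

lemma fockRep_single (a : WickIdx n) (x : ℂ) :
    fockRep (Finsupp.single a x) = x • monomialOp a := by
  simp [fockRep]

lemma finMul_single (a b : WickIdx n) (x y : ℂ) :
    finMul (Finsupp.single a x) (Finsupp.single b y) = (x * y) • monomialMul a b := by
  simp [finMul, mul_smul]

lemma le_of_prod_descFactorial_ne_zero {v w : Fin n → ℕ}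
    (h : ∏ i, ((v i).descFactorial (w i) : ℂ) ≠ 0) (i : Fin n) : w i ≤ v i := by
  have h1 := prod_ne_zero_iff.mp h i (mem_univ i)
  rw [Nat.cast_ne_zero, Ne, Nat.descFactorial_eq_zero_iff_lt] at h1
  omega

lemma fockRep_monomialMul (a b : WickIdx n) :
    fockRep (monomialMul a b) = monomialOp a * monomialOp b := by
  refine Finsupp.lhom_ext fun p x => ?_
  rw [Module.End.mul_apply, monomialOp_single, monomialOp_single, monomialMul, map_sum,
    LinearMap.sum_apply]
  have key : ∀ μ ∈ Fintype.piFinset (fun i => range (a.2.1 i + 1)),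
      fockRep (Finsupp.single (monomialIdx a b μ) (monomialCoeff a b μ)) (Finsupp.single p x) =
      Finsupp.single (p.1 + b.1 + (∑ i, b.2.1 i : ℕ) + a.1 + (∑ i, a.2.1 i : ℕ),
        p.2 - b.2.1 + b.2.2 - a.2.1 + a.2.2)
        (x * ((-1 : ℂ) ^ (∑ i, b.2.1 i) * (-1 : ℂ) ^ (∑ i, a.2.1 i)) *
          ∏ i, (((a.2.1 i).choose (μ i) * (b.2.2 i).descFactorial (μ i) *
            (p.2 i).descFactorial (a.2.1 i + b.2.1 i - μ i) : ℕ) : ℂ)) := by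
    intro μ hμ
    have hμ : ∀ i, μ i ≤ a.2.1 i := by simpa [Fintype.mem_piFinset, Nat.lt_succ_iff] using hμ
    have hsum : ∑ i, μ i + ∑ i, (a.2.1 + b.2.1 - μ) i = ∑ i, a.2.1 i + ∑ i, b.2.1 i := by
      rw [← sum_add_distrib, ← sum_add_distrib]
      refine sum_congr rfl fun i _ => ?_
      have := hμ i
      simp only [Pi.sub_apply, Pi.add_apply]
      omega
    rw [fockRep_single, LinearMap.smul_apply, monomialOp_single, Finsupp.smul_single]
    have hc : monomialCoeff a b μ • (x * ((-1 : ℂ) ^ (∑ i, (monomialIdx a b μ).2.1 i) *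
        ∏ i, ((p.2 i).descFactorial ((monomialIdx a b μ).2.1 i) : ℂ))) =
        x * ((-1 : ℂ) ^ (∑ i, b.2.1 i) * (-1 : ℂ) ^ (∑ i, a.2.1 i)) *
          ∏ i, (((a.2.1 i).choose (μ i) * (b.2.2 i).descFactorial (μ i) *
            (p.2 i).descFactorial (a.2.1 i + b.2.1 i - μ i) : ℕ) : ℂ) := by
      simp only [monomialCoeff, monomialIdx, smul_eq_mul, Nat.cast_mul, prod_mul_distrib,
        Pi.sub_apply, Pi.add_apply] at hsum ⊢
      rw [← pow_add, add_comm (∑ i, b.2.1 i), ← hsum, pow_add]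
      ring
    rw [hc]
    by_cases hz : ∏ i, (((a.2.1 i).choose (μ i) * (b.2.2 i).descFactorial (μ i) *
            (p.2 i).descFactorial (a.2.1 i + b.2.1 i - μ i) : ℕ) : ℂ) = 0
    · rw [hz, mul_zero, Finsupp.single_zero, Finsupp.single_zero]
    · congr 1
      have hz' : ∀ i, μ i ≤ b.2.2 i ∧ a.2.1 i + b.2.1 i - μ i ≤ p.2 i := by
        intro i
        have h1 := prod_ne_zero_iff.mp hz i (mem_univ i)
        rw [Nat.cast_ne_zero, mul_ne_zero_iff, mul_ne_zero_iff, Ne, Ne, Ne,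
          Nat.descFactorial_eq_zero_iff_lt, Nat.descFactorial_eq_zero_iff_lt] at h1
        omega
      refine Prod.ext ?_ ?_
      · simp only [monomialIdx]
        zify at hsum
        push_cast
        linarith
      · funext i
        have := hz' i
        have := hμ i
        simp only [monomialIdx, Pi.sub_apply, Pi.add_apply]
        omega
  rw [sum_congr rfl key, ← Finsupp.single_finsetSum, ← mul_sum]
  congr 1
  rw [← prod_univ_sum (fun i => range (a.2.1 i + 1)) fun i m =>
    (((a.2.1 i).choose m * (b.2.2 i).descFactorial m *
            (p.2 i).descFactorial (a.2.1 i + b.2.1 i - m) : ℕ) : ℂ)]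
  simp only [← Nat.cast_sum, ← descFactorial_mul_descFactorial_eq, Pi.sub_apply, Pi.add_apply]
  simp only [Nat.cast_mul, prod_mul_distrib]
  ring

lemma fockRep_finMul (f g : FinSum n) : fockRep (finMul f g) = fockRep f * fockRep g := by
  induction f using Finsupp.induction_linear with
  | zero => simp
  | add f₁ f₂ h₁ h₂ => simp [h₁, h₂, add_mul]
  | single a x =>
    induction g using Finsupp.induction_linear with
    | zero => simp
    | add g₁ g₂ h₁ h₂ => simp [h₁, h₂, mul_add]
    | single b y =>
      rw [finMul_single, map_smul, fockRep_monomialMul, fockRep_single, fockRep_single,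
        smul_mul_smul_comm]

lemma fockRep_injective : Function.Injective (fockRep (n := n)) := by
  rw [injective_iff_map_eq_zero]
  intro f hf
  by_contra hne
  obtain ⟨a, ha, hmin⟩ := exists_min_image f.support (fun a => ∑ i, a.2.1 i)
    (Finsupp.support_nonempty_iff.mpr hne)
  have h : fockRep f (Finsupp.single (0, a.2.1) 1) (a.1 + (∑ i, a.2.1 i : ℕ), a.2.2) = 0 := by
    simp [hf]
  rw [fockRep, Finsupp.linearCombination_apply, Finsupp.sum, LinearMap.sum_apply,
    Finsupp.finsetSum_apply, sum_eq_single a] at h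
  · rw [LinearMap.smul_apply, monomialOp_single] at h
    simp only [zero_add, tsub_self, Nat.descFactorial_self, Finsupp.smul_apply,
      Finsupp.single_eq_same, smul_eq_mul, one_mul, mul_eq_zero, Finsupp.mem_support_iff] at h ha
    rcases h with h | h | h
    · exact ha h
    · exact pow_ne_zero _ (by norm_num) h
    · exact prod_ne_zero_iff.mpr (fun i _ => Nat.cast_ne_zero.mpr (Nat.factorial_ne_zero _)) h
  · intro b hb hba
    rw [LinearMap.smul_apply, monomialOp_single, Finsupp.smul_apply]
    by_cases hz : ∏ i, ((a.2.1 i).descFactorial (b.2.1 i) : ℂ) = 0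
    · simp [hz]
    · have hle := le_of_prod_descFactorial_ne_zero hz
      have hα : b.2.1 = a.2.1 := by
        funext i
        exact (sum_eq_sum_iff_of_le fun i _ => hle i).mp
          (le_antisymm (sum_le_sum fun i _ => hle i) (hmin b hb)) i (mem_univ i)
      rw [Finsupp.single_eq_of_ne, smul_zero]
      intro he
      apply hba
      simp only [hα, Prod.mk.injEq] at he
      refine Prod.ext ?_ (Prod.ext hα ?_)
      · linarith [he.1]
      · simpa using he.2.symm
  · exact fun h => absurd ha h

lemma exists_ne_zero_of_finsum_ne_zero {ι M : Type*} [AddCommMonoid M] {F : ι → M}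
    (h : ∑ᶠ i, F i ≠ 0) : ∃ i, F i ≠ 0 := by
  contrapose! h
  simp [h]

/-- The indices of the coefficients of the two factors in `wickTerm`. -/
lemma exists_of_wickTerm_ne_zero {f g : WickIdx n → ℂ} {t : WickIdx n}
    {q : (Fin n → ℕ) × ℤ × (Fin n → ℕ) × (Fin n → ℕ)} (h : wickTerm f g t q ≠ 0) :
    f (q.2.1, q.2.2.1 + q.1, q.2.2.2) ≠ 0 ∧
    g (t.1 - q.2.1 - (∑ i, q.1 i : ℕ), t.2.1 - q.2.2.1, (t.2.2 - q.2.2.2) + q.1) ≠ 0 ∧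
    (∀ i, q.2.2.1 i ≤ t.2.1 i) ∧ (∀ i, q.2.2.2 i ≤ t.2.2 i) := by
  unfold wickTerm at h
  split_ifs at h with hc
  · refine ⟨fun h0 => h ?_, fun h0 => h ?_, hc⟩ <;> rw [h0] <;> ring
  · exact absurd rfl h

lemma totalDeg_add_totalDeg {t : WickIdx n} {q : (Fin n → ℕ) × ℤ × (Fin n → ℕ) × (Fin n → ℕ)}
    (h₁ : ∀ i, q.2.2.1 i ≤ t.2.1 i) (h₂ : ∀ i, q.2.2.2 i ≤ t.2.2 i) :
    totalDeg (n := n) (q.2.1, q.2.2.1 + q.1, q.2.2.2) +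
    totalDeg (n := n) (t.1 - q.2.1 - (∑ i, q.1 i : ℕ), t.2.1 - q.2.2.1,
      (t.2.2 - q.2.2.2) + q.1) = totalDeg t := by
  have e₁ : ∑ i, (t.2.1 i - q.2.2.1 i) + ∑ i, q.2.2.1 i = ∑ i, t.2.1 i := by
    rw [← sum_add_distrib]
    exact sum_congr rfl fun i _ => Nat.sub_add_cancel (h₁ i)
  have e₂ : ∑ i, (t.2.2 i - q.2.2.2 i) + ∑ i, q.2.2.2 i = ∑ i, t.2.2 i := by
    rw [← sum_add_distrib]
    exact sum_congr rfl fun i _ => Nat.sub_add_cancel (h₂ i)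
  simp only [totalDeg, Pi.add_apply, Pi.sub_apply, sum_add_distrib]
  rw [← e₁, ← e₂]
  push_cast
  ring

lemma finite_support_wickTerm (f : FinSum n) (g : WickIdx n → ℂ) (t : WickIdx n) :
    (Function.support (wickTerm f g t)).Finite := by
  refine Set.Finite.subset (f.support.finite_toSet.biUnion fun a _ =>
    (Set.finite_Iic a.2.1).prod ((Set.finite_singleton a.1).prod
      ((Set.finite_Iic a.2.1).prod (Set.finite_singleton a.2.2)))) fun q hq => ?_
  rw [Set.mem_iUnion₂]
  refine ⟨_, Finsupp.mem_support_iff.mpr (exists_of_wickTerm_ne_zero hq).1, ?_⟩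
  simp [Set.mem_prod]

lemma wickTerm_add_left (f₁ f₂ g : WickIdx n → ℂ) (t : WickIdx n)
    (q : (Fin n → ℕ) × ℤ × (Fin n → ℕ) × (Fin n → ℕ)) :
    wickTerm (f₁ + f₂) g t q = wickTerm f₁ g t q + wickTerm f₂ g t q := by
  unfold wickTerm
  split_ifs
  · simp only [Pi.add_apply f₁ f₂]
    ring
  · simp

lemma wickTerm_add_right (f g₁ g₂ : WickIdx n → ℂ) (t : WickIdx n)
    (q : (Fin n → ℕ) × ℤ × (Fin n → ℕ) × (Fin n → ℕ)) :
    wickTerm f (g₁ + g₂) t q = wickTerm f g₁ t q + wickTerm f g₂ t q := by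
  unfold wickTerm
  split_ifs
  · simp only [Pi.add_apply g₁ g₂]
    ring
  · simp

lemma wickMul_single (a b : WickIdx n) (x y : ℂ) (t : WickIdx n) :
    wickMul (Finsupp.single a x) (Finsupp.single b y) t = ((x * y) • monomialMul a b) t := by
  have hinj : Function.Injective fun μ : Fin n → ℕ => (μ, a.1, a.2.1 - μ, a.2.2) :=
    fun μ ν h => congrArg Prod.fst h
  unfold wickMul
  rw [finsum_eq_sum_of_support_subset (s := (Fintype.piFinset fun i =>
      range (a.2.1 i + 1)).map ⟨_, hinj⟩), sum_map, monomialMul, smul_sum,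
    Finsupp.finsetSum_apply]
  · refine sum_congr rfl fun μ hμ => ?_
    have hμ : ∀ i, μ i ≤ a.2.1 i := by simpa [Fintype.mem_piFinset, Nat.lt_succ_iff] using hμ
    rw [Finsupp.smul_apply, Function.Embedding.coeFn_mk]
    have hadd : a.2.1 - μ + μ = a.2.1 := by
      funext i
      exact Nat.sub_add_cancel (hμ i)
    by_cases ht : monomialIdx a b μ = t ∧ ∀ i, μ i ≤ b.2.2 i
    · obtain ⟨rfl, hb⟩ := ht
      rw [Finsupp.single_eq_same, wickTerm, if_pos]
      · have hα : (monomialIdx a b μ).2.1 - (a.2.1 - μ) = b.2.1 := by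
          funext i
          have := hμ i
          simp only [monomialIdx, Pi.sub_apply, Pi.add_apply]
          omega
        have hβ : (monomialIdx a b μ).2.2 - a.2.2 + μ = b.2.2 := by
          funext i
          have := hb i
          simp only [monomialIdx, Pi.sub_apply, Pi.add_apply]
          omega
        have hβ' : ∀ i, (monomialIdx a b μ).2.2 i - a.2.2 i = b.2.2 i - μ i := by
          intro i
          have := hb i
          simp only [monomialIdx, Pi.sub_apply, Pi.add_apply]
          omega
        have hk : (monomialIdx a b μ).1 - a.1 - (∑ i, μ i : ℕ) = b.1 := by
          simp only [monomialIdx]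
          ring
        simp only [hα, hβ, hk, hadd, hβ', Prod.mk.eta, Finsupp.single_eq_same, Pi.sub_apply,
          monomialCoeff, smul_eq_mul, prod_div_distrib, prod_mul_distrib]
        have e₁ : ∀ i, a.2.1 i - μ i + μ i = a.2.1 i := fun i => Nat.sub_add_cancel (hμ i)
        have e₂ : ∀ i, b.2.2 i - μ i + μ i = b.2.2 i := fun i => Nat.sub_add_cancel (hb i)
        have e₃ : ∏ i, ((a.2.1 i).factorial : ℂ) = (∏ i, ((a.2.1 i).choose (μ i) : ℂ)) *
            (∏ i, ((μ i).factorial : ℂ)) * ∏ i, ((a.2.1 i - μ i).factorial : ℂ) := by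
          rw [← prod_mul_distrib, ← prod_mul_distrib]
          refine prod_congr rfl fun i _ => ?_
          exact_mod_cast (Nat.choose_mul_factorial_mul_factorial (hμ i)).symm
        have e₄ : ∏ i, ((b.2.2 i).factorial : ℂ) = (∏ i, ((b.2.2 i - μ i).factorial : ℂ)) *
            ∏ i, ((b.2.2 i).descFactorial (μ i) : ℂ) := by
          rw [← prod_mul_distrib]
          refine prod_congr rfl fun i _ => ?_
          exact_mod_cast (Nat.factorial_mul_descFactorial (hb i)).symm
        have hne : ∀ v : Fin n → ℕ, ∏ i, ((v i).factorial : ℂ) ≠ 0 := fun v =>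
          prod_ne_zero_iff.mpr fun i _ => Nat.cast_ne_zero.mpr (Nat.factorial_ne_zero _)
        simp only [e₁, e₂]
        rw [e₃, e₄]
        have h₁ := hne μ
        have h₂ := hne fun i => a.2.1 i - μ i
        have h₃ := hne fun i => b.2.2 i - μ i
        field_simp
      · constructor <;> intro i
        · have := hμ i
          simp only [monomialIdx, Pi.sub_apply, Pi.add_apply]
          omega
        · have := hb i
          simp only [monomialIdx, Pi.sub_apply, Pi.add_apply]
          omega
    · have hR : Finsupp.single (monomialIdx a b μ) (monomialCoeff a b μ) t = 0 := by
        by_cases hi : monomialIdx a b μ = t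
        · have hb : monomialCoeff a b μ = 0 := by
            by_contra hne
            rw [monomialCoeff, prod_mul_distrib] at hne
            exact ht ⟨hi, le_of_prod_descFactorial_ne_zero
              (right_ne_zero_of_mul (right_ne_zero_of_mul hne))⟩
          simp [hb]
        · exact Finsupp.single_eq_of_ne (Ne.symm hi)
      rw [hR, smul_zero]
      by_contra hne
      obtain ⟨-, hg, hα, hβ⟩ := exists_of_wickTerm_ne_zero hne
      simp only [Pi.sub_apply] at hg hα hβ
      have hg := (Finsupp.single_apply_ne_zero.mp hg).1
      apply ht
      obtain ⟨h₁, h₂, h₃⟩ := by simpa only [Prod.ext_iff] using hg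
      refine ⟨Prod.ext ?_ (Prod.ext ?_ ?_), fun i => ?_⟩
      · simp only [monomialIdx]
        linarith
      · funext i
        have := congrFun h₂ i
        have := hα i
        have := hμ i
        simp only [monomialIdx, Pi.sub_apply, Pi.add_apply] at *
        omega
      · funext i
        have := congrFun h₃ i
        have := hβ i
        simp only [monomialIdx, Pi.sub_apply, Pi.add_apply] at *
        omega
      · have := congrFun h₃ i
        simp only [Pi.sub_apply, Pi.add_apply] at this
        omega
  · intro q hq
    have ha := (Finsupp.single_apply_ne_zero.mp (exists_of_wickTerm_ne_zero hq).1).1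
    subst ha
    simp only [coe_map, Function.Embedding.coeFn_mk, Set.mem_image, mem_coe]
    refine ⟨q.1, ?_, ?_⟩
    · simp [Fintype.mem_piFinset]
    · simp

lemma wickMul_coe (f g : FinSum n) : wickMul f g = finMul f g := by
  funext t
  induction f using Finsupp.induction_linear with
  | zero => simp [wickMul, wickTerm]
  | add f₁ f₂ h₁ h₂ =>
    rw [map_add, LinearMap.add_apply, Finsupp.add_apply, ← h₁, ← h₂, Finsupp.coe_add]
    simp only [wickMul, wickTerm_add_left]
    exact finsum_add_distrib (finite_support_wickTerm _ _ _) (finite_support_wickTerm _ _ _)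
  | single a x =>
    induction g using Finsupp.induction_linear with
    | zero => simp [wickMul, wickTerm]
    | add g₁ g₂ h₁ h₂ =>
      rw [map_add, Finsupp.add_apply, ← h₁, ← h₂, Finsupp.coe_add]
      simp only [wickMul, wickTerm_add_right]
      exact finsum_add_distrib (finite_support_wickTerm _ _ _) (finite_support_wickTerm _ _ _)
    | single b y => rw [finMul_single, wickMul_single]

/-- The homogeneous component of total degree `d`. -/
noncomputable def component {f : WickIdx n → ℂ} (hf : MemWickPlus f) (d : ℕ) : FinSum n :=
  Finsupp.ofSupportFinite (fun t => if totalDeg t = d then f t else 0) <|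
    (hf.2 d).subset fun t ht => by simpa [and_comm] using ht

lemma component_apply {f : WickIdx n → ℂ} (hf : MemWickPlus f) (d : ℕ) (t : WickIdx n) :
    component hf d t = if totalDeg t = d then f t else 0 := rfl

/-- The finite formal sums that are homogeneous of total degree `d`. -/
def homogeneous (n d : ℕ) : Submodule ℂ (FinSum n) :=
  Finsupp.supported ℂ ℂ {t | totalDeg t = d}

lemma mem_homogeneous {f : FinSum n} {d : ℕ} :
    f ∈ homogeneous n d ↔ ∀ t, f t ≠ 0 → totalDeg t = d := by
  simp [homogeneous, Finsupp.mem_supported, Set.subset_def]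

lemma component_mem {f : WickIdx n → ℂ} (hf : MemWickPlus f) (d : ℕ) :
    component hf d ∈ homogeneous n d := by
  rw [mem_homogeneous]
  intro t ht
  rw [component_apply] at ht
  by_contra h
  simp [h] at ht

lemma finMul_mem {f g : FinSum n} {d e : ℕ} (hf : f ∈ homogeneous n d)
    (hg : g ∈ homogeneous n e) : finMul f g ∈ homogeneous n (d + e) := by
  rw [mem_homogeneous] at *
  intro t ht
  rw [← wickMul_coe] at ht
  obtain ⟨q, hq⟩ := exists_ne_zero_of_finsum_ne_zero ht
  obtain ⟨h₁, h₂, h₃, h₄⟩ := exists_of_wickTerm_ne_zero hq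
  rw [← totalDeg_add_totalDeg h₃ h₄, hf _ h₁, hg _ h₂]
  simp

lemma wickMul_apply {f g : WickIdx n → ℂ} (hf : MemWickPlus f) (hg : MemWickPlus g) {d : ℕ}
    {t : WickIdx n} (ht : totalDeg t = d) :
    wickMul f g t =
      (∑ p ∈ antidiagonal d, finMul (component hf p.1) (component hg p.2)) t := by
  rw [Finsupp.finsetSum_apply]
  simp only [← wickMul_coe]
  unfold wickMul
  rw [← finsum_sum_comm _ _ fun p _ => finite_support_wickTerm _ _ _]
  refine finsum_congr fun q => ?_
  by_cases hc : (∀ i, q.2.2.1 i ≤ t.2.1 i) ∧ (∀ i, q.2.2.2 i ≤ t.2.2 i)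
  · have hdeg := totalDeg_add_totalDeg hc.1 hc.2
    simp only [wickTerm, if_pos hc, component_apply]
    by_cases hfa : f (q.2.1, q.2.2.1 + q.1, q.2.2.2) = 0
    · simp [hfa]
    by_cases hgb : g (t.1 - q.2.1 - (∑ i, q.1 i : ℕ), t.2.1 - q.2.2.1,
        (t.2.2 - q.2.2.2) + q.1) = 0
    · simp only [hgb, ite_self, zero_mul, mul_zero, sum_const_zero]
    obtain ⟨i, hi⟩ := Int.eq_ofNat_of_zero_le (hf.1 _ hfa)
    obtain ⟨j, hj⟩ := Int.eq_ofNat_of_zero_le (hg.1 _ hgb)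
    rw [hi, hj, ht] at hdeg
    rw [sum_eq_single (i, j)]
    · simp only [hi, hj, if_true]
    · rintro ⟨i', j'⟩ hp hne
      rw [HasAntidiagonal.mem_antidiagonal] at hp
      have hii : (i : ℤ) ≠ i' := by
        intro h
        apply hne
        ext <;> simp at * <;> omega
      simp [hi, hii]
    · intro h
      exact absurd (HasAntidiagonal.mem_antidiagonal.mpr (by exact_mod_cast hdeg)) h
  · simp [wickTerm, if_neg hc]

lemma memWickPlus_wickMul {f g : WickIdx n → ℂ} (hf : MemWickPlus f) (hg : MemWickPlus g) :
    MemWickPlus (wickMul f g) := by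
  have hnonneg : ∀ t, wickMul f g t ≠ 0 → 0 ≤ totalDeg t := by
    intro t ht
    obtain ⟨q, hq⟩ := exists_ne_zero_of_finsum_ne_zero ht
    obtain ⟨h₁, h₂, h₃, h₄⟩ := exists_of_wickTerm_ne_zero hq
    rw [← totalDeg_add_totalDeg h₃ h₄]
    exact add_nonneg (hf.1 _ h₁) (hg.1 _ h₂)
  refine ⟨hnonneg, fun d => ?_⟩
  refine ((∑ p ∈ antidiagonal d.toNat,
    finMul (component hf p.1) (component hg p.2)).support.finite_toSet).subset ?_
  rintro t ⟨ht, rfl⟩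
  rw [mem_coe, Finsupp.mem_support_iff, ← wickMul_apply hf hg (t := t)]
  · exact ht
  · exact (Int.toNat_of_nonneg (hnonneg t ht)).symm

lemma component_wickMul {f g : WickIdx n → ℂ} (hf : MemWickPlus f) (hg : MemWickPlus g)
    (hfg : MemWickPlus (wickMul f g)) (d : ℕ) :
    component hfg d = ∑ p ∈ antidiagonal d, finMul (component hf p.1) (component hg p.2) := by
  ext t
  rw [component_apply]
  split_ifs with ht
  · exact wickMul_apply hf hg ht
  · have hmem : ∑ p ∈ antidiagonal d, finMul (component hf p.1) (component hg p.2) ∈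
        homogeneous n d := by
      refine Submodule.sum_mem _ fun p hp => ?_
      rw [← HasAntidiagonal.mem_antidiagonal.mp hp]
      exact finMul_mem (component_mem _ _) (component_mem _ _)
    by_contra hne
    exact ht (mem_homogeneous.mp hmem t (Ne.symm hne))

/-- The power series of Fock operators of the homogeneous components. -/
noncomputable def fockSeries {f : WickIdx n → ℂ} (hf : MemWickPlus f) :
    PowerSeries (Module.End ℂ (Fock n)) :=
  PowerSeries.mk fun d => fockRep (component hf d)

lemma fockSeries_wickMul {f g : WickIdx n → ℂ} (hf : MemWickPlus f) (hg : MemWickPlus g)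
    (hfg : MemWickPlus (wickMul f g)) :
    fockSeries hfg = fockSeries hf * fockSeries hg := by
  ext1 d
  simp [fockSeries, PowerSeries.coeff_mul, component_wickMul hf hg, fockRep_finMul]

lemma eq_of_fockSeries_eq {f g : WickIdx n → ℂ} {hf : MemWickPlus f} {hg : MemWickPlus g}
    (h : fockSeries hf = fockSeries hg) : f = g := by
  funext t
  by_cases ht : 0 ≤ totalDeg t
  · obtain ⟨d, hd⟩ := Int.eq_ofNat_of_zero_le ht
    have h₁ := congrArg (PowerSeries.coeff d) h
    simp only [fockSeries, PowerSeries.coeff_mk] at h₁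
    have h₂ := DFunLike.congr_fun (fockRep_injective h₁) t
    simpa [component_apply, hd] using h₂
  · rw [not_imp_comm.mp (hf.1 t) ht, not_imp_comm.mp (hg.1 t) ht]

lemma totalDeg_zero : totalDeg ((0 : ℤ), (0 : Fin n → ℕ), (0 : Fin n → ℕ)) = 0 := by
  simp [totalDeg]

lemma memWickPlus_cOne : MemWickPlus (cOne (n := n)) := by
  have h : ∀ t : WickIdx n, cOne t ≠ 0 → t = (0, 0, 0) := by
    intro t ht
    by_contra h
    simp [cOne, h] at ht
  refine ⟨fun t ht => ?_, fun d => (Set.finite_singleton _).subset fun t ht => h t ht.1⟩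
  rw [h t ht, totalDeg_zero]

lemma component_eq_single {f : WickIdx n → ℂ} (hf : MemWickPlus f)
    (h : ∀ t, totalDeg t = 0 → f t = cOne t) :
    component hf 0 = Finsupp.single (0, 0, 0) 1 := by
  ext t
  rw [component_apply, Finsupp.single_apply]
  by_cases ht : totalDeg t = 0
  · simp [ht, h t ht, cOne, eq_comm]
  · rw [if_neg (by simpa using ht), if_neg]
    rintro rfl
    exact ht totalDeg_zero

lemma fockRep_one : fockRep (Finsupp.single ((0, 0, 0) : WickIdx n) 1) = 1 := by
  refine Finsupp.lhom_ext fun p x => ?_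
  rw [fockRep_single, one_smul, monomialOp_single]
  simp

lemma fockSeries_cOne : fockSeries (memWickPlus_cOne (n := n)) = 1 := by
  ext1 d
  rw [fockSeries, PowerSeries.coeff_mk, PowerSeries.coeff_one]
  split_ifs with hd
  · subst hd
    rw [component_eq_single _ fun _ _ => rfl, fockRep_one]
  · have h0 : component (memWickPlus_cOne (n := n)) d = 0 := by
      ext t
      rw [component_apply]
      split_ifs with ht
      · rw [cOne, if_neg]
        · rfl
        · rintro rfl
          rw [totalDeg_zero] at ht
          exact hd (by exact_mod_cast ht.symm)
      · rfl
    rw [h0, map_zero]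

/-- A power series whose coefficients represent homogeneous sums comes from `𝒲⁺`. -/
lemma exists_fockSeries_eq {V : PowerSeries (Module.End ℂ (Fock n))}
    (hV : ∀ d, PowerSeries.coeff d V ∈ (homogeneous n d).map fockRep) :
    ∃ (u : WickIdx n → ℂ) (hu : MemWickPlus u), fockSeries hu = V := by
  choose w hw hwV using fun d => Submodule.mem_map.mp (hV d)
  have hu : MemWickPlus fun t : WickIdx n =>
      if 0 ≤ totalDeg t then w (totalDeg t).toNat t else 0 := by
    refine ⟨fun t ht => ?_, fun d => ?_⟩
    · by_contra h
      simp [h] at ht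
    · refine (w d.toNat).support.finite_toSet.subset ?_
      rintro t ⟨ht, rfl⟩
      rw [mem_coe, Finsupp.mem_support_iff]
      exact fun h => ht (by simp [h])
  refine ⟨_, hu, ?_⟩
  ext1 d
  rw [fockSeries, PowerSeries.coeff_mk, ← hwV]
  congr 1
  ext t
  rw [component_apply]
  split_ifs with h₁ h₂
  · simp [h₁]
  · omega
  · by_contra hne
    exact h₁ (mem_homogeneous.mp (hw d) t (Ne.symm hne))

lemma exists_inverse_of_coeff_zero_eq_one {R : Type*} [Ring R] {F : PowerSeries R}
    (h : PowerSeries.coeff 0 F = 1) : ∃ V, F * V = 1 ∧ V * F = 1 := by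
  have h' : PowerSeries.constantCoeff F = (1 : Rˣ) := by
    rw [← PowerSeries.coeff_zero_eq_constantCoeff_apply, h, Units.val_one]
  exact ⟨_, F.mul_invOfUnit 1 h', F.invOfUnit_mul 1 h'⟩

/-- An element of `𝒲⁺` with degree zero part `1` is invertible for the Wick product. -/
theorem existsUnique_wickMul_inverse {f : WickIdx n → ℂ} (hf : MemWickPlus f)
    (h : ∀ t, totalDeg t = 0 → f t = cOne t) :
    ∃! u : WickIdx n → ℂ, MemWickPlus u ∧ wickMul f u = cOne ∧ wickMul u f = cOne := by
  have h0 : PowerSeries.coeff 0 (fockSeries hf) = 1 := by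
    rw [fockSeries, PowerSeries.coeff_mk, component_eq_single hf h, fockRep_one]
  obtain ⟨V, hfV, hVf⟩ := exists_inverse_of_coeff_zero_eq_one (R := Module.End ℂ (Fock n)) h0
  have hV : ∀ d, PowerSeries.coeff d V ∈ (homogeneous n d).map fockRep := by
    intro d
    induction d using Nat.strong_induction_on with
    | _ d ih =>
      have hd := congrArg (PowerSeries.coeff d) hfV
      rw [PowerSeries.coeff_mul, Nat.sum_antidiagonal_eq_sum_range_succ_mk, sum_range_succ',
        h0, one_mul, tsub_zero] at hd
      have hone : PowerSeries.coeff d (1 : PowerSeries (Module.End ℂ (Fock n))) ∈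
          (homogeneous n d).map fockRep := by
        rw [← fockSeries_cOne, fockSeries, PowerSeries.coeff_mk]
        exact Submodule.mem_map_of_mem (component_mem _ _)
      rw [← hd] at hone
      have hsum : ∑ k ∈ range d, PowerSeries.coeff (k + 1) (fockSeries hf) *
          PowerSeries.coeff (d - (k + 1)) V ∈ (homogeneous n d).map fockRep := by
        refine Submodule.sum_mem _ fun k hk => ?_
        have hk := mem_range.mp hk
        obtain ⟨w, hw, hwV⟩ := Submodule.mem_map.mp (ih (d - (k + 1)) (by omega))
        rw [← hwV, fockSeries, PowerSeries.coeff_mk, ← fockRep_finMul]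
        refine Submodule.mem_map_of_mem ?_
        have := finMul_mem (component_mem hf (k + 1)) hw
        rwa [Nat.add_sub_cancel' (by omega)] at this
      exact (Submodule.add_mem_iff_right (R := ℂ) (M := Module.End ℂ (Fock n)) _ hsum).mp hone
  obtain ⟨u, hu, rfl⟩ := exists_fockSeries_eq hV
  refine ⟨u, ⟨hu, ?_, ?_⟩, ?_⟩
  · refine eq_of_fockSeries_eq (hf := memWickPlus_wickMul hf hu) (hg := memWickPlus_cOne) ?_
    rw [fockSeries_wickMul hf hu, hfV, fockSeries_cOne]
  · refine eq_of_fockSeries_eq (hf := memWickPlus_wickMul hu hf) (hg := memWickPlus_cOne) ?_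
    rw [fockSeries_wickMul hu hf, hVf, fockSeries_cOne]
  · rintro v ⟨hv, -, hvf⟩
    refine eq_of_fockSeries_eq (hf := hv) (hg := hu) (left_inv_eq_right_inv ?_ hfV)
    rw [← fockSeries_wickMul hv hf (memWickPlus_wickMul hv hf), ← fockSeries_cOne]
    congr

section Exponential

variable {φ : WickIdx n → ℂ}

lemma le_of_cPow_ne_zero (hφW : ∀ t : WickIdx n, t.1 < 0 → φ t = 0)
    (hφ3 : ∀ t : WickIdx n, φ t ≠ 0 → 3 ≤ totalDeg t) (m : ℕ) (t : WickIdx n)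
    (ht : cPow φ m t ≠ 0) : 0 ≤ t.1 ∧ 3 * (m : ℤ) ≤ totalDeg t := by
  induction m generalizing t with
  | zero =>
    have h : t = (0, 0, 0) := by
      by_contra h
      simp [cPow, cOne, h] at ht
    subst h
    simp [totalDeg_zero]
  | succ m ih =>
    obtain ⟨q, hq⟩ := exists_ne_zero_of_finsum_ne_zero ht
    split_ifs at hq with hc
    · have h₁ := left_ne_zero_of_mul hq
      obtain ⟨h₂, h₃⟩ := ih _ (right_ne_zero_of_mul hq)
      have h₄ : 0 ≤ q.1 := by
        by_contra h
        exact h₁ (hφW q (by omega))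
      have h₅ := hφ3 q h₁
      have hdeg := totalDeg_add_totalDeg (q := (0, q)) hc.1 hc.2
      simp only [add_zero, Pi.zero_apply, sum_const_zero, Nat.cast_zero, sub_zero] at hdeg
      simp only [Prod.mk.eta] at hdeg
      push_cast
      constructor
      · simp only at h₂
        omega
      · omega
    · exact absurd rfl hq

lemma le_of_expTerm_ne_zero (hφW : ∀ t : WickIdx n, t.1 < 0 → φ t = 0)
    (hφ3 : ∀ t : WickIdx n, φ t ≠ 0 → 3 ≤ totalDeg t) {t : WickIdx n} {m : ℕ}
    (ht : expTerm φ t m ≠ 0) : 0 ≤ t.1 + m ∧ (m : ℤ) ≤ totalDeg t := by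
  obtain ⟨h₁, h₂⟩ := le_of_cPow_ne_zero hφW hφ3 m _ (right_ne_zero_of_mul ht)
  refine ⟨h₁, ?_⟩
  simp only [totalDeg] at h₂ ⊢
  omega

lemma finite_support_expTerm (hφW : ∀ t : WickIdx n, t.1 < 0 → φ t = 0)
    (hφ3 : ∀ t : WickIdx n, φ t ≠ 0 → 3 ≤ totalDeg t) (t : WickIdx n) :
    (Function.support (expTerm φ t)).Finite := by
  refine (Set.finite_Iic (totalDeg t).toNat).subset fun m hm => ?_
  have := (le_of_expTerm_ne_zero hφW hφ3 hm).2
  rw [Set.mem_Iic]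
  omega

lemma memWickPlus_wickExp (hφW : ∀ t : WickIdx n, t.1 < 0 → φ t = 0)
    (hφ3 : ∀ t : WickIdx n, φ t ≠ 0 → 3 ≤ totalDeg t) : MemWickPlus (wickExp φ) := by
  have h : ∀ t, wickExp φ t ≠ 0 → 0 ≤ totalDeg t ∧ -totalDeg t ≤ t.1 := by
    intro t ht
    obtain ⟨m, hm⟩ := exists_ne_zero_of_finsum_ne_zero ht
    have := le_of_expTerm_ne_zero hφW hφ3 hm
    omega
  refine ⟨fun t ht => (h t ht).1, fun d => ?_⟩
  refine ((Set.finite_Icc (-d) d).prod ((Set.finite_Iic (fun _ : Fin n => (3 * d).toNat)).prod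
    (Set.finite_Iic (fun _ : Fin n => (3 * d).toNat)))).subset ?_
  rintro t ⟨ht, rfl⟩
  obtain ⟨h₁, h₂⟩ := h t ht
  have e : totalDeg t = 2 * t.1 + (∑ i, t.2.1 i : ℕ) + (∑ i, t.2.2 i : ℕ) := rfl
  refine ⟨⟨h₂, by omega⟩, fun i => ?_, fun i => ?_⟩
  · have := single_le_sum (f := t.2.1) (fun _ _ => Nat.zero_le _) (mem_univ i)
    change t.2.1 i ≤ (3 * totalDeg t).toNat
    omega
  · have := single_le_sum (f := t.2.2) (fun _ _ => Nat.zero_le _) (mem_univ i)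
    change t.2.2 i ≤ (3 * totalDeg t).toNat
    omega

lemma wickExp_of_totalDeg_eq_zero (hφW : ∀ t : WickIdx n, t.1 < 0 → φ t = 0)
    (hφ3 : ∀ t : WickIdx n, φ t ≠ 0 → 3 ≤ totalDeg t) (t : WickIdx n) (ht : totalDeg t = 0) :
    wickExp φ t = cOne t := by
  rw [wickExp, finsum_eq_single _ 0]
  · simp [expTerm, cPow]
  · intro m hm
    by_contra hne
    have := (le_of_expTerm_ne_zero hφW hφ3 hne).2
    omega

end Exponential

end Wick

/-- If `φ ∈ 𝒲` has all nonzero monomials of total degree `≥ 3`, then `e^{φ/ℏ}` is a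
well-defined element of the extended Wick algebra `𝒲⁺` (each coefficient receives only
finitely many contributions), and it is invertible in `𝒲⁺` for the Wick product, with a
unique two-sided inverse. -/
theorem wickExp_wellDefined_and_invertible (n : ℕ) (φ : WickIdx n → ℂ)
    (hφW : ∀ t : WickIdx n, t.1 < 0 → φ t = 0)
    (hφ3 : ∀ t : WickIdx n, φ t ≠ 0 → 3 ≤ totalDeg t) :
    (∀ t : WickIdx n, (Function.support (expTerm φ t)).Finite) ∧
    MemWickPlus (wickExp φ) ∧
    (∃! u : WickIdx n → ℂ, MemWickPlus u ∧
      wickMul (wickExp φ) u = cOne ∧ wickMul u (wickExp φ) = cOne) := by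
  have hexp := Wick.memWickPlus_wickExp hφW hφ3
  exact ⟨Wick.finite_support_expTerm hφW hφ3, hexp,
    Wick.existsUnique_wickMul_inverse hexp (Wick.wickExp_of_totalDeg_eq_zero hφW hφ3)⟩
end

section
/- Let 𝒲 = ℂ[[z¹,…,zⁿ, z̄¹,…,z̄ⁿ]][[ℏ]] ⊆ 𝒲⁺ with the Wick product ⋆, and let φ ∈ 𝒲 have all nonzero monomials of total degree 2k + |α| + |β| ≥ 3, so that e^{φ/ℏ} is a well-defined invertible element of the extended Wick algebra 𝒲⁺. Then for every f ∈ 𝒲 there exists a unique element O_f ∈ 𝒲 such that f · e^{φ/ℏ} = e^{φ/ℏ} ⋆ O_f in 𝒲⁺, where · denotes the commutative product of formal sums and ⋆ the Wick product. Moreover, if f is a single monomial, then O_f = f + (terms of total degree strictly greater than the total degree of f). -/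
namespace WickAlgebra

open Finset

variable {n : ℕ}

/-- Families supported on nonnegative powers of `ℏ`, i.e. elements of `𝒲`. -/
def IsFormal (c : WickIdx n → ℂ) : Prop := ∀ t : WickIdx n, t.1 < 0 → c t = 0

lemma IsFormal.nonneg {c : WickIdx n → ℂ} (hc : IsFormal c) {t : WickIdx n} (h : c t ≠ 0) :
    0 ≤ t.1 :=
  not_lt.1 fun h' => h (hc t h')

lemma IsFormal.add {c d : WickIdx n → ℂ} (hc : IsFormal c) (hd : IsFormal d) :
    IsFormal (c + d) := fun t ht => by simp [hc t ht, hd t ht]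

lemma IsFormal.sub {c d : WickIdx n → ℂ} (hc : IsFormal c) (hd : IsFormal d) :
    IsFormal (c - d) := fun t ht => by simp [hc t ht, hd t ht]

lemma totalDeg_nonneg {t : WickIdx n} (h : 0 ≤ t.1) : 0 ≤ totalDeg t := by
  unfold totalDeg; positivity

lemma totalDeg_add (s t : WickIdx n) : totalDeg (s + t) = totalDeg s + totalDeg t := by
  simp only [totalDeg, Prod.fst_add, Prod.snd_add, Pi.add_apply, sum_add_distrib]
  push_cast; ring

lemma add_split {t : WickIdx n} {q : WickIdx n} (h₁ : ∀ i, q.2.1 i ≤ t.2.1 i)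
    (h₂ : ∀ i, q.2.2 i ≤ t.2.2 i) :
    q + (t.1 - q.1, t.2.1 - q.2.1, t.2.2 - q.2.2) = t := by
  refine Prod.ext (by simp) (Prod.ext ?_ ?_)
  · funext i; simpa using Nat.add_sub_cancel' (h₁ i)
  · funext i; simpa using Nat.add_sub_cancel' (h₂ i)

lemma totalDeg_wick_split {t : WickIdx n} {q : (Fin n → ℕ) × WickIdx n}
    (h₁ : ∀ i, q.2.2.1 i ≤ t.2.1 i) (h₂ : ∀ i, q.2.2.2 i ≤ t.2.2 i) :
    totalDeg (n := n) (q.2.1, q.2.2.1 + q.1, q.2.2.2) +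
      totalDeg (n := n) (t.1 - q.2.1 - (∑ i, q.1 i : ℕ), t.2.1 - q.2.2.1,
        (t.2.2 - q.2.2.2) + q.1) = totalDeg t := by
  conv_rhs => rw [← add_split h₁ h₂, totalDeg_add]
  simp only [totalDeg, Pi.add_apply, sum_add_distrib]
  push_cast; ring

/-- Families of the form `1 + (terms of positive total degree)`. -/
structure IsUnipotent (ε : WickIdx n → ℂ) : Prop where
  apply_zero : ε 0 = 1
  eq_or_pos : ∀ t, ε t ≠ 0 → t = 0 ∨ 0 < totalDeg t

lemma IsUnipotent.totalDeg_nonneg {ε : WickIdx n → ℂ} (hε : IsUnipotent ε) {t : WickIdx n}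
    (h : ε t ≠ 0) : 0 ≤ totalDeg t := by
  rcases hε.eq_or_pos t h with rfl | h
  · simp [totalDeg]
  · exact h.le

lemma wickTerm_ne_zero {f g : WickIdx n → ℂ} {t : WickIdx n} {q : (Fin n → ℕ) × WickIdx n}
    (h : wickTerm f g t q ≠ 0) :
    (∀ i, q.2.2.1 i ≤ t.2.1 i) ∧ (∀ i, q.2.2.2 i ≤ t.2.2 i) ∧
      f (q.2.1, q.2.2.1 + q.1, q.2.2.2) ≠ 0 ∧
      g (t.1 - q.2.1 - (∑ i, q.1 i : ℕ), t.2.1 - q.2.2.1, (t.2.2 - q.2.2.2) + q.1) ≠ 0 := by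
  unfold wickTerm at h
  split_ifs at h with h'
  · refine ⟨h'.1, h'.2, fun h0 => h ?_, fun h0 => h ?_⟩ <;> rw [h0] <;> simp
  · exact absurd rfl h

/-- At a monomial below which `O` vanishes, `ε ⋆ O` and `O` have the same coefficient. -/
lemma wickMul_apply_of_vanish {ε O : WickIdx n → ℂ} (hε : IsUnipotent ε) (t : WickIdx n)
    (hO : ∀ s, totalDeg s < totalDeg t → O s = 0) : wickMul ε O t = O t := by
  unfold wickMul
  rw [finsum_eq_single _ 0]
  · have h0 : ε (0, 0, 0) = 1 := hε.apply_zero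
    simp [wickTerm, h0, div_self, Nat.factorial_ne_zero]
  · rintro q hq
    by_contra h
    obtain ⟨h₁, h₂, hf, hg⟩ := wickTerm_ne_zero h
    have hdeg := totalDeg_wick_split h₁ h₂
    rcases hε.eq_or_pos _ hf with h0 | hpos
    · refine hq ?_
      obtain ⟨γ, k, a, b⟩ := q
      simp only [Prod.mk_eq_zero] at h0 ⊢
      have h' : a = 0 ∧ γ = 0 := by
        constructor <;> funext i <;> have := congrFun h0.2.1 i <;> simp at this ⊢ <;> omega
      exact ⟨h'.2, h0.1, h'.1, h0.2.2⟩
    · exact hg (hO _ (by omega))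

/-- At a monomial below which `f` vanishes, `f · ε` and `f` have the same coefficient. -/
lemma cMul_apply_of_vanish {ε f : WickIdx n → ℂ} (hε : IsUnipotent ε) (t : WickIdx n)
    (hf : ∀ s, totalDeg s < totalDeg t → f s = 0) : cMul f ε t = f t := by
  unfold cMul
  rw [finsum_eq_single _ t]
  · have h0 : ε (0, 0, 0) = 1 := hε.apply_zero
    simp [h0]
  · intro q hq
    by_contra h
    split_ifs at h with h'
    · have hsplit := add_split h'.1 h'.2
      have hdeg := congrArg totalDeg hsplit
      rw [totalDeg_add] at hdeg
      rcases hε.eq_or_pos _ (right_ne_zero_of_mul h) with h0 | hpos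
      · rw [h0, add_zero] at hsplit
        exact hq hsplit
      · exact left_ne_zero_of_mul h (hf q (by omega))
    · exact h rfl

lemma wickTerm_support_finite {ε O : WickIdx n → ℂ} (hε : IsUnipotent ε) (hO : IsFormal O)
    (t : WickIdx n) : (Function.support (wickTerm ε O t)).Finite := by
  set N := (totalDeg t).toNat
  refine Set.Finite.subset (s := Set.Iic (fun _ => N) ×ˢ
    (Set.Icc (-((∑ i, t.2.1 i : ℕ) + (∑ i, t.2.2 i : ℕ) + N : ℤ)) t.1 ×ˢ
      (Set.Iic t.2.1 ×ˢ Set.Iic t.2.2))) ?_ ?_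
  · exact (Set.finite_Iic _).prod ((Set.finite_Icc _ _).prod
      ((Set.finite_Iic _).prod (Set.finite_Iic _)))
  · rintro ⟨γ, k, a, b⟩ hq
    obtain ⟨h₁, h₂, hf, hg⟩ := wickTerm_ne_zero hq
    have hf' := hε.totalDeg_nonneg hf
    have hg' := hO.nonneg hg
    have ha : ∑ i, a i ≤ ∑ i, t.2.1 i := sum_le_sum fun i _ => h₁ i
    have hb : ∑ i, b i ≤ ∑ i, t.2.2 i := sum_le_sum fun i _ => h₂ i
    simp only [totalDeg, Pi.add_apply, sum_add_distrib, Nat.cast_add] at hf' hg'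
    have hγ : ∑ i, γ i ≤ N := by
      simp only [N, totalDeg]; omega
    refine ⟨fun i => (single_le_sum (fun _ _ => Nat.zero_le _) (mem_univ i)).trans hγ,
      ⟨?_, ?_⟩, h₁, h₂⟩
    · simp only; omega
    · simp only; omega

lemma sum_le_toNat_of_wickTerm_ne_zero {ε O : WickIdx n → ℂ} (hε : IsUnipotent ε)
    (hO : IsFormal O) {t : WickIdx n} {q : (Fin n → ℕ) × WickIdx n}
    (hq : wickTerm ε O t q ≠ 0) : ∑ i, q.1 i ≤ (totalDeg t).toNat := by
  obtain ⟨γ, k, a, b⟩ := q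
  obtain ⟨h₁, h₂, hf, hg⟩ := wickTerm_ne_zero hq
  have hf' := hε.totalDeg_nonneg hf
  have hg' := hO.nonneg hg
  have ha : ∑ i, a i ≤ ∑ i, t.2.1 i := sum_le_sum fun i _ => h₁ i
  have hb : ∑ i, b i ≤ ∑ i, t.2.2 i := sum_le_sum fun i _ => h₂ i
  simp only [totalDeg, Pi.add_apply, sum_add_distrib, Nat.cast_add] at hf' hg' ⊢
  omega

lemma wickMul_add {ε O O' : WickIdx n → ℂ} (hε : IsUnipotent ε) (hO : IsFormal O)
    (hO' : IsFormal O') : wickMul ε (O + O') = wickMul ε O + wickMul ε O' := by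
  funext t
  rw [Pi.add_apply]
  unfold wickMul
  rw [← finsum_add_distrib (wickTerm_support_finite hε hO t)
    (wickTerm_support_finite hε hO' t)]
  refine finsum_congr fun q => ?_
  unfold wickTerm
  split_ifs
  · simp only [Pi.add_apply]; ring
  · simp

lemma wickMul_sub {ε O O' : WickIdx n → ℂ} (hε : IsUnipotent ε) (hO : IsFormal O)
    (hO' : IsFormal O') : wickMul ε (O - O') = wickMul ε O - wickMul ε O' := by
  rw [eq_sub_iff_add_eq, ← wickMul_add hε (hO.sub hO') hO', sub_add_cancel]

lemma cMul_support_finite {ε f : WickIdx n → ℂ} (hε : IsUnipotent ε) (hf : IsFormal f)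
    (t : WickIdx n) : (Function.support fun q : WickIdx n =>
      open Classical in
      if (∀ i, q.2.1 i ≤ t.2.1 i) ∧ (∀ i, q.2.2 i ≤ t.2.2 i) then
        f q * ε (t.1 - q.1, t.2.1 - q.2.1, t.2.2 - q.2.2)
      else 0).Finite := by
  refine Set.Finite.subset (s := Set.Icc 0 (totalDeg t) ×ˢ (Set.Iic t.2.1 ×ˢ Set.Iic t.2.2)) ?_ ?_
  · exact (Set.finite_Icc _ _).prod ((Set.finite_Iic _).prod (Set.finite_Iic _))
  · rintro q hq
    rw [Function.mem_support] at hq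
    split_ifs at hq with h'
    · have hdeg := congrArg totalDeg (add_split h'.1 h'.2)
      rw [totalDeg_add] at hdeg
      have h₁ := hf.nonneg (left_ne_zero_of_mul hq)
      have h₂ := hε.totalDeg_nonneg (right_ne_zero_of_mul hq)
      refine ⟨⟨h₁, ?_⟩, h'⟩
      have : q.1 ≤ totalDeg q := by unfold totalDeg; omega
      omega
    · exact absurd rfl hq

lemma add_cMul {ε f g : WickIdx n → ℂ} (hε : IsUnipotent ε) (hf : IsFormal f)
    (hg : IsFormal g) : cMul (f + g) ε = cMul f ε + cMul g ε := by
  funext t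
  rw [Pi.add_apply]
  unfold cMul
  rw [← finsum_add_distrib (cMul_support_finite hε hf t) (cMul_support_finite hε hg t)]
  refine finsum_congr fun q => ?_
  split_ifs
  · simp only [Pi.add_apply]; ring
  · simp

lemma sub_cMul {ε f g : WickIdx n → ℂ} (hε : IsUnipotent ε) (hf : IsFormal f)
    (hg : IsFormal g) : cMul (f - g) ε = cMul f ε - cMul g ε := by
  rw [eq_sub_iff_add_eq, ← add_cMul hε (hf.sub hg) hg, sub_add_cancel]

lemma wickMul_zero (ε : WickIdx n → ℂ) : wickMul ε 0 = 0 := by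
  funext t
  simp [wickMul, wickTerm]

lemma zero_cMul (ε : WickIdx n → ℂ) : cMul 0 ε = 0 := by
  funext t
  simp [cMul]

/-- Strong induction on the total degree for families in `𝒲`. -/
lemma vanish_of_step {c : WickIdx n → ℂ} (hc : IsFormal c) {d : ℤ}
    (h : ∀ t, totalDeg t < d → (∀ s, totalDeg s < totalDeg t → c s = 0) → c t = 0) :
    ∀ t, totalDeg t < d → c t = 0 := by
  suffices H : ∀ (N : ℕ) (t : WickIdx n), totalDeg t < N → totalDeg t < d → c t = 0 from
    fun t => H ((totalDeg t).toNat + 1) t (by omega)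
  intro N
  induction N with
  | zero =>
    intro t ht _
    by_contra h0
    have := totalDeg_nonneg (hc.nonneg h0)
    omega
  | succ N ih =>
    intro t ht htd
    exact h t htd fun s hs => ih s (by omega) (by omega)

lemma eq_of_vanish_left {ε f O : WickIdx n → ℂ} (hε : IsUnipotent ε) (hO : IsFormal O)
    (h : cMul f ε = wickMul ε O) {d : ℤ} (hf : ∀ t, totalDeg t < d → f t = 0)
    {t : WickIdx n} (ht : totalDeg t ≤ d) : O t = f t := by
  have hO' : ∀ t, totalDeg t < d → O t = 0 := vanish_of_step hO fun t ht hs => by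
    rw [← wickMul_apply_of_vanish hε t hs, ← h,
      cMul_apply_of_vanish hε t fun s hs => hf s (hs.trans ht), hf t ht]
  rw [← wickMul_apply_of_vanish hε t fun s hs => hO' s (hs.trans_le ht), ← h,
    cMul_apply_of_vanish hε t fun s hs => hf s (hs.trans_le ht)]

lemma eq_of_vanish_right {ε f O : WickIdx n → ℂ} (hε : IsUnipotent ε) (hf : IsFormal f)
    (h : cMul f ε = wickMul ε O) {d : ℤ} (hO : ∀ t, totalDeg t < d → O t = 0)
    {t : WickIdx n} (ht : totalDeg t ≤ d) : f t = O t := by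
  have hf' : ∀ t, totalDeg t < d → f t = 0 := vanish_of_step hf fun t ht hs => by
    rw [← cMul_apply_of_vanish hε t hs, h,
      wickMul_apply_of_vanish hε t fun s hs => hO s (hs.trans ht), hO t ht]
  rw [← cMul_apply_of_vanish hε t fun s hs => hf' s (hs.trans_le ht), h,
    wickMul_apply_of_vanish hε t fun s hs => hO s (hs.trans_le ht)]

lemma wickMul_injective {ε O O' : WickIdx n → ℂ} (hε : IsUnipotent ε) (hO : IsFormal O)
    (hO' : IsFormal O') (h : wickMul ε O = wickMul ε O') : O = O' := by
  funext t
  have h0 : cMul 0 ε = wickMul ε (O - O') := by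
    rw [wickMul_sub hε hO hO', h, sub_self, zero_cMul]
  exact sub_eq_zero.1 (eq_of_vanish_left hε (hO.sub hO') h0 (d := totalDeg t)
    (fun _ _ => rfl) le_rfl)

/-- If each `ε ⋆ O` with `O ∈ 𝒲` is of the form `x · ε` with `x ∈ 𝒲`, then conversely each
`f · ε` with `f ∈ 𝒲` is of the form `ε ⋆ O` with `O ∈ 𝒲`. -/
lemma exists_wickMul_eq {ε : WickIdx n → ℂ} (hε : IsUnipotent ε)
    (H : ∀ O : WickIdx n → ℂ, IsFormal O → ∃ x, IsFormal x ∧ cMul x ε = wickMul ε O)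
    {f : WickIdx n → ℂ} (hf : IsFormal f) : ∃ O, IsFormal O ∧ cMul f ε = wickMul ε O := by
  choose! X hX hXε using H
  let r : ℕ → WickIdx n → ℂ := fun m => Nat.rec f (fun _ g => g - X g) m
  have hr_succ : ∀ m, r (m + 1) = r m - X (r m) := fun _ => rfl
  have hr : ∀ m, IsFormal (r m) := fun m => by
    induction m with
    | zero => exact hf
    | succ m ih => exact ih.sub (hX _ ih)
  have hr_vanish : ∀ (m : ℕ) (t : WickIdx n), totalDeg t < m → r m t = 0 := fun m => by
    induction m with
    | zero =>
      intro t ht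
      by_contra h0
      have := totalDeg_nonneg ((hr 0).nonneg h0)
      omega
    | succ m ih =>
      intro t ht
      rw [hr_succ, Pi.sub_apply, sub_eq_zero]
      exact (eq_of_vanish_right hε (hX _ (hr m)) (hXε _ (hr m)) ih (by omega)).symm
  let S : ℕ → WickIdx n → ℂ := fun M => ∑ m ∈ range M, r m
  have hS_succ : ∀ M, S (M + 1) = S M + r M := fun M => sum_range_succ _ _
  have hS : ∀ M, IsFormal (S M) := fun M => by
    induction M with
    | zero => intro t _; simp [S]
    | succ M ih => rw [hS_succ]; exact ih.add (hr M)
  have hSε : ∀ M, wickMul ε (S M) = cMul (f - r M) ε := fun M => by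
    induction M with
    | zero => simp [S, r, wickMul_zero, zero_cMul]
    | succ M ih =>
      rw [hS_succ, wickMul_add hε (hS M) (hr M), ih, ← hXε _ (hr M),
        ← add_cMul hε (hf.sub (hr M)) (hX _ (hr M)), hr_succ]
      congr 1
      abel
  have hS_eq : ∀ (t : WickIdx n) (M : ℕ), (totalDeg t).toNat < M →
      S M t = S ((totalDeg t).toNat + 1) t := fun t M hM => by
    simp only [S, Finset.sum_apply]
    refine (sum_subset (range_subset_range.2 (by omega)) fun m _ hm => hr_vanish m t ?_).symm
    simp only [mem_range] at hm
    omega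
  refine ⟨fun t => S ((totalDeg t).toNat + 1) t, fun t ht => hS _ t ht, ?_⟩
  have hO : IsFormal fun t => S ((totalDeg t).toNat + 1) t := fun t ht => hS _ t ht
  funext t
  set M := (totalDeg t).toNat + 1 with hM
  have htM : totalDeg t < M := by omega
  have h₁ := wickMul_apply_of_vanish hε (O := (fun t => S ((totalDeg t).toNat + 1) t) - S M) t
    fun s hs => sub_eq_zero.2 (hS_eq s M (by omega)).symm
  rw [wickMul_sub hε hO (hS M), Pi.sub_apply, Pi.sub_apply, ← hM, sub_self, sub_eq_zero] at h₁
  rw [h₁, hSε, sub_cMul hε hf (hr M), Pi.sub_apply,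
    cMul_apply_of_vanish hε t fun s hs => hr_vanish M s (hs.trans htM), hr_vanish M t htM, sub_zero]

/-- The operator `ℏ^{|γ|} ∂_z^γ` on coefficient families. -/
noncomputable def dz (γ : Fin n → ℕ) (c : WickIdx n → ℂ) : WickIdx n → ℂ := fun t =>
  (∏ i, (((t.2.1 i + γ i).factorial : ℂ) / ((t.2.1 i).factorial : ℂ))) *
    c (t.1 - (∑ i, γ i : ℕ), t.2.1 + γ, t.2.2)

/-- The operator `∂_{z̄}^γ` on coefficient families. -/
noncomputable def dzbar (γ : Fin n → ℕ) (c : WickIdx n → ℂ) : WickIdx n → ℂ := fun t =>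
  (∏ i, (((t.2.2 i + γ i).factorial : ℂ) / ((t.2.2 i).factorial : ℂ))) *
    c (t.1, t.2.1, t.2.2 + γ)

/-- The coefficient `(-1)^{|γ|} / γ!` in the Wick product. -/
noncomputable def wickCoeff (γ : Fin n → ℕ) : ℂ :=
  (-1 : ℂ) ^ (∑ i, γ i) / ∏ i, ((γ i).factorial : ℂ)

lemma IsFormal.dzbar {c : WickIdx n → ℂ} (hc : IsFormal c) (γ : Fin n → ℕ) :
    IsFormal (dzbar γ c) := fun t ht => by
  simp [WickAlgebra.dzbar, hc (t.1, t.2.1, t.2.2 + γ) ht]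

lemma wickMul_eq_sum {ε O : WickIdx n → ℂ} (hε : IsUnipotent ε) (hO : IsFormal O)
    (t : WickIdx n) {N : ℕ} (hN : totalDeg t ≤ N) :
    wickMul ε O t =
      ∑ γ ∈ Iic (fun _ : Fin n => N), wickCoeff γ * cMul (dz γ ε) (dzbar γ O) t := by
  have hterm : ∀ γ : Fin n → ℕ, ∑ᶠ r : WickIdx n, wickTerm ε O t (γ, r) =
      wickCoeff γ * cMul (dz γ ε) (dzbar γ O) t := fun γ => by
    unfold cMul
    rw [← smul_eq_mul, smul_finsum]
    refine (finsum_congr fun r => ?_).trans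
      (finsum_comp_equiv ((Equiv.addRight ((∑ i, γ i : ℕ) : ℤ)).prodCongr (Equiv.refl _)))
    simp only [wickTerm, Equiv.prodCongr_apply, Prod.map, Equiv.refl_apply, Equiv.coe_addRight]
    split_ifs with h
    · simp only [dz, dzbar, wickCoeff, smul_eq_mul, add_sub_cancel_right, ← sub_sub, Pi.sub_apply]
      ring
    · simp
  unfold wickMul
  rw [finsum_curry _ (wickTerm_support_finite hε hO t), finsum_congr hterm]
  refine finsum_eq_sum_of_support_subset _ fun γ hγ => ?_
  rw [Function.mem_support, ← hterm] at hγ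
  obtain ⟨r, hr⟩ : ∃ r, wickTerm ε O t (γ, r) ≠ 0 := by
    by_contra! h
    exact hγ (finsum_eq_zero_of_forall_eq_zero h)
  have hle := sum_le_toNat_of_wickTerm_ne_zero hε hO hr
  rw [coe_Iic]
  exact fun i => (single_le_sum (f := γ) (fun _ _ => Nat.zero_le _) (mem_univ i)).trans
    (hle.trans (Int.toNat_le.2 hN))

/-- The exponents `ℏᵏ z^α z̄^β` with `k + |α| + |β| ≥ 0` are those of a power series ring:
`none` stands for `ℏ`, and `some (inl i)`, `some (inr i)` stand for `ℏ⁻¹ zⁱ`, `ℏ⁻¹ z̄ⁱ`. -/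
abbrev Var (n : ℕ) := Option (Fin n ⊕ Fin n)

/-- The monomial with given exponents in the variables `ℏ`, `ℏ⁻¹ z`, `ℏ⁻¹ z̄`. -/
def toIdx (s : Var n →₀ ℕ) : WickIdx n :=
  (s none - (∑ i, s (some (.inl i)) : ℕ) - (∑ i, s (some (.inr i)) : ℕ),
    fun i => s (some (.inl i)), fun i => s (some (.inr i)))

/-- The exponents in the variables `ℏ`, `ℏ⁻¹ z`, `ℏ⁻¹ z̄` of a monomial. -/
noncomputable def ofIdx (t : WickIdx n) : Var n →₀ ℕ :=
  Finsupp.equivFunOnFinite.symm fun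
    | none => (t.1 + (∑ i, t.2.1 i : ℕ) + (∑ i, t.2.2 i : ℕ)).toNat
    | some (.inl i) => t.2.1 i
    | some (.inr i) => t.2.2 i

/-- The cone of monomials `ℏᵏ z^α z̄^β` with `k + |α| + |β| ≥ 0`. -/
def InCone (t : WickIdx n) : Prop := 0 ≤ t.1 + (∑ i, t.2.1 i : ℕ) + (∑ i, t.2.2 i : ℕ)

lemma inCone_of_nonneg {t : WickIdx n} (h : 0 ≤ t.1) : InCone t := by
  unfold InCone; positivity

lemma inCone_toIdx (s : Var n →₀ ℕ) : InCone (toIdx s) := by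
  simp only [InCone, toIdx]
  omega

lemma toIdx_ofIdx {t : WickIdx n} (h : InCone t) : toIdx (ofIdx t) = t := by
  unfold InCone at h
  refine Prod.ext ?_ rfl
  simp only [toIdx, ofIdx, Finsupp.equivFunOnFinite_symm_apply_apply]
  omega

lemma ofIdx_toIdx (s : Var n →₀ ℕ) : ofIdx (toIdx s) = s := by
  ext (_ | i | i)
  · simp only [toIdx, ofIdx, Finsupp.equivFunOnFinite_symm_apply_apply]
    omega
  · rfl
  · rfl

lemma toIdx_injective : Function.Injective (toIdx (n := n)) :=
  Function.LeftInverse.injective ofIdx_toIdx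

lemma toIdx_add (s s' : Var n →₀ ℕ) : toIdx (s + s') = toIdx s + toIdx s' := by
  refine Prod.ext ?_ rfl
  simp only [toIdx, Finsupp.add_apply, sum_add_distrib, Prod.fst_add]
  push_cast; ring

lemma toIdx_zero : toIdx (0 : Var n →₀ ℕ) = 0 := by
  refine Prod.ext ?_ rfl
  simp [toIdx]

open Classical in
/-- The coefficient family of a power series in the variables `ℏ`, `ℏ⁻¹ z`, `ℏ⁻¹ z̄`. -/
noncomputable def toFam (F : MvPowerSeries (Var n) ℂ) : WickIdx n → ℂ := fun t =>
  if InCone t then F.coeff (ofIdx t) else 0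

/-- The power series in the variables `ℏ`, `ℏ⁻¹ z`, `ℏ⁻¹ z̄` of a coefficient family. -/
noncomputable def ofFam (c : WickIdx n → ℂ) : MvPowerSeries (Var n) ℂ := fun s => c (toIdx s)

lemma coeff_ofFam (c : WickIdx n → ℂ) (s : Var n →₀ ℕ) : (ofFam c).coeff s = c (toIdx s) := rfl

lemma toFam_toIdx (F : MvPowerSeries (Var n) ℂ) (s : Var n →₀ ℕ) :
    toFam F (toIdx s) = F.coeff s := by
  rw [toFam, if_pos (inCone_toIdx s), ofIdx_toIdx]

lemma toFam_of_not_inCone (F : MvPowerSeries (Var n) ℂ) {t : WickIdx n} (h : ¬ InCone t) :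
    toFam F t = 0 := if_neg h

lemma exists_toIdx_of_toFam_ne_zero {F : MvPowerSeries (Var n) ℂ} {t : WickIdx n}
    (h : toFam F t ≠ 0) : ∃ s, toIdx s = t ∧ F.coeff s ≠ 0 := by
  have ht : InCone t := by
    by_contra h'
    exact h (toFam_of_not_inCone F h')
  exact ⟨ofIdx t, toIdx_ofIdx ht, by rwa [toFam, if_pos ht] at h⟩

lemma toFam_ofFam {c : WickIdx n → ℂ} (hc : IsFormal c) : toFam (ofFam c) = c := by
  funext t
  by_cases ht : InCone t
  · rw [toFam, if_pos ht, coeff_ofFam, toIdx_ofIdx ht]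
  · rw [toFam_of_not_inCone _ ht, hc t]
    by_contra! h
    exact ht (inCone_of_nonneg h)

lemma toFam_eq_of_toIdx {F : MvPowerSeries (Var n) ℂ} {c : WickIdx n → ℂ}
    (h : ∀ s, c (toIdx s) = F.coeff s) (h' : ∀ t, ¬ InCone t → c t = 0) : c = toFam F := by
  funext t
  by_cases ht : InCone t
  · rw [← toIdx_ofIdx ht, h, toFam_toIdx]
  · rw [toFam_of_not_inCone _ ht, h' t ht]

lemma cMul_toFam (F G : MvPowerSeries (Var n) ℂ) :
    cMul (toFam F) (toFam G) = toFam (F * G) := by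
  classical
  have key : ∀ t q : WickIdx n, (if (∀ i, q.2.1 i ≤ t.2.1 i) ∧ (∀ i, q.2.2 i ≤ t.2.2 i) then
      toFam F q * toFam G (t.1 - q.1, t.2.1 - q.2.1, t.2.2 - q.2.2) else 0) ≠ 0 →
      ∃ a b, toIdx a = q ∧ toIdx (a + b) = t := by
    intro t q h
    split_ifs at h with h'
    · obtain ⟨a, ha, -⟩ := exists_toIdx_of_toFam_ne_zero (left_ne_zero_of_mul h)
      obtain ⟨b, hb, -⟩ := exists_toIdx_of_toFam_ne_zero (right_ne_zero_of_mul h)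
      exact ⟨a, b, ha, by rw [toIdx_add, ha, hb, add_split h'.1 h'.2]⟩
    · exact absurd rfl h
  refine toFam_eq_of_toIdx (fun s => ?_) fun t ht => ?_
  · unfold cMul
    rw [finsum_eq_sum_of_support_subset _ (s := (antidiagonal s).image fun p => toIdx p.1),
      sum_image, MvPowerSeries.coeff_mul]
    · refine sum_congr rfl fun p hp => ?_
      obtain rfl := mem_antidiagonal.1 hp
      have hb : ((toIdx (p.1 + p.2)).1 - (toIdx p.1).1, (toIdx (p.1 + p.2)).2.1 - (toIdx p.1).2.1,
          (toIdx (p.1 + p.2)).2.2 - (toIdx p.1).2.2) = toIdx p.2 := by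
        rw [toIdx_add]
        simp
      rw [if_pos, hb, toFam_toIdx, toFam_toIdx]
      constructor <;> intro i <;> simp [toIdx]
    · intro p hp p' hp' h
      have h₁ := toIdx_injective h
      have h₂ := (mem_antidiagonal.1 hp).trans (mem_antidiagonal.1 hp').symm
      rw [h₁] at h₂
      exact Prod.ext h₁ (add_left_cancel h₂)
    · intro q hq
      obtain ⟨a, b, rfl, hab⟩ := key _ q hq
      exact mem_coe.2 (mem_image.2 ⟨(a, b), mem_antidiagonal.2 (toIdx_injective hab), rfl⟩)
  · refine finsum_eq_zero_of_forall_eq_zero fun q => ?_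
    by_contra h
    obtain ⟨a, b, -, hab⟩ := key t q h
    exact ht (hab ▸ inCone_toIdx _)

/-- All monomials of the power series have `ℏ`-exponent at least `k` and total degree at
least `d`. -/
def LowerBound (k d : ℤ) (F : MvPowerSeries (Var n) ℂ) : Prop :=
  ∀ s, F.coeff s ≠ 0 → k ≤ (toIdx s).1 ∧ d ≤ totalDeg (toIdx s)

lemma LowerBound.mono {k k' d d' : ℤ} {F : MvPowerSeries (Var n) ℂ} (h : LowerBound k d F)
    (hk : k' ≤ k) (hd : d' ≤ d) : LowerBound k' d' F := fun s hs =>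
  ⟨hk.trans (h s hs).1, hd.trans (h s hs).2⟩

lemma LowerBound.add {k d : ℤ} {F G : MvPowerSeries (Var n) ℂ}
    (hF : LowerBound k d F) (hG : LowerBound k d G) : LowerBound k d (F + G) := fun s hs => by
  by_cases h : F.coeff s = 0
  · exact hG s fun h' => hs (by rw [map_add, h, h', add_zero])
  · exact hF s h

lemma LowerBound.mul {k d k' d' : ℤ} {F G : MvPowerSeries (Var n) ℂ}
    (hF : LowerBound k d F) (hG : LowerBound k' d' G) :
    LowerBound (k + k') (d + d') (F * G) := fun s hs => by
  classical
  rw [MvPowerSeries.coeff_mul] at hs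
  obtain ⟨p, hp, hne⟩ := exists_ne_zero_of_sum_ne_zero hs
  obtain rfl := mem_antidiagonal.1 hp
  have h₁ := hF _ (left_ne_zero_of_mul hne)
  have h₂ := hG _ (right_ne_zero_of_mul hne)
  rw [toIdx_add, totalDeg_add]
  exact ⟨add_le_add h₁.1 h₂.1, add_le_add h₁.2 h₂.2⟩

lemma lowerBound_one : LowerBound 0 0 (1 : MvPowerSeries (Var n) ℂ) := fun s hs => by
  classical
  have : s = 0 := by
    by_contra h
    exact hs (by rw [MvPowerSeries.coeff_one, if_neg h])
  subst this
  simp [toIdx_zero, totalDeg]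

lemma LowerBound.pow {k d : ℤ} {F : MvPowerSeries (Var n) ℂ} (hF : LowerBound k d F) (m : ℕ) :
    LowerBound (m * k) (m * d) (F ^ m) := by
  induction m with
  | zero => simpa using lowerBound_one
  | succ m ih =>
    rw [pow_succ]
    refine (ih.mul hF).mono ?_ ?_ <;> push_cast <;> linarith

lemma toIdx_single_inl (i : Fin n) :
    toIdx (Finsupp.single (some (.inl i)) 1) = ((-1 : ℤ), Pi.single i 1, 0) := by
  refine Prod.ext ?_ (Prod.ext ?_ ?_)
  · simp [toIdx, Finsupp.single_apply]
  · funext j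
    simp [toIdx, Finsupp.single_apply, Pi.single_apply, eq_comm]
  · funext j
    simp [toIdx]

lemma totalDeg_single_inl (i : Fin n) :
    totalDeg (toIdx (Finsupp.single (some (.inl i)) 1)) = -1 := by
  simp [toIdx_single_inl, totalDeg]

lemma LowerBound.pderiv {k d : ℤ} {F : MvPowerSeries (Var n) ℂ} (hF : LowerBound k d F)
    (i : Fin n) : LowerBound (k + 1) (d + 1) (MvPowerSeries.pderiv ℂ (some (.inl i)) F) :=
  fun s hs => by
  rw [MvPowerSeries.coeff_pderiv] at hs
  have h := hF _ (left_ne_zero_of_mul hs)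
  rw [toIdx_add, totalDeg_add, totalDeg_single_inl, toIdx_single_inl, Prod.fst_add] at h
  constructor <;> linarith

lemma isFormal_toFam {d : ℤ} {F : MvPowerSeries (Var n) ℂ} (hF : LowerBound 0 d F) :
    IsFormal (toFam F) := fun t ht => by
  by_contra h
  obtain ⟨s, rfl, hs⟩ := exists_toIdx_of_toFam_ne_zero h
  exact absurd (hF s hs).1 (by omega)

lemma lowerBound_ofFam {c : WickIdx n → ℂ} (hc : IsFormal c) : LowerBound 0 0 (ofFam c) :=
  fun _ hs => ⟨hc.nonneg hs, totalDeg_nonneg (hc.nonneg hs)⟩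

lemma dz_zero (c : WickIdx n → ℂ) : dz 0 c = c := by
  funext t
  simp [dz, div_self, Nat.factorial_ne_zero]

lemma dz_add_single (γ : Fin n → ℕ) (i : Fin n) (c : WickIdx n → ℂ) (t : WickIdx n) :
    dz (γ + Pi.single i 1) c t =
      (t.2.1 i + 1) * dz γ c (t.1 - 1, t.2.1 + Pi.single i 1, t.2.2) := by
  have hfac : ∏ j, (((t.2.1 + Pi.single i 1 : Fin n → ℕ) j).factorial : ℂ) =
      (t.2.1 i + 1) * ∏ j, ((t.2.1 j).factorial : ℂ) := by
    rw [← mul_prod_erase _ _ (mem_univ i), ← mul_prod_erase univ (fun j => ((t.2.1 j).factorial : ℂ))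
      (mem_univ i), ← mul_assoc]
    congr 1
    · simp [Nat.factorial_succ]
    · refine prod_congr rfl fun j hj => ?_
      simp [Pi.single_eq_of_ne (ne_of_mem_erase hj)]
  have hne : ∀ α : Fin n → ℕ, ∏ j, ((α j).factorial : ℂ) ≠ 0 := fun α =>
    prod_ne_zero_iff.2 fun j _ => Nat.cast_ne_zero.2 (Nat.factorial_ne_zero _)
  have hne' : (t.2.1 i + 1 : ℂ) ≠ 0 := Nat.cast_add_one_ne_zero _
  have hidx : t.2.1 + (γ + Pi.single i 1) = t.2.1 + Pi.single i 1 + γ := by abel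
  have hsum : t.1 - ((∑ j, (γ + Pi.single i 1 : Fin n → ℕ) j : ℕ) : ℤ) =
      t.1 - 1 - (∑ j, γ j : ℕ) := by
    simp [sum_add_distrib]; ring
  have hprod : ∀ j, t.2.1 j + (γ + Pi.single i 1 : Fin n → ℕ) j =
      (t.2.1 + Pi.single i 1 : Fin n → ℕ) j + γ j := fun j => congrFun hidx j
  simp only [dz, hsum, hidx, hprod, prod_div_distrib, hfac]
  have := hne t.2.1
  field_simp

lemma dz_single_toFam {γ : Fin n → ℕ} {c : WickIdx n → ℂ} {F : MvPowerSeries (Var n) ℂ}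
    (h : dz γ c = toFam F) (i : Fin n) :
    dz (γ + Pi.single i 1) c = toFam (MvPowerSeries.pderiv ℂ (some (.inl i)) F) := by
  refine toFam_eq_of_toIdx (fun s => ?_) fun t ht => ?_
  · have hs : ((toIdx s).1 - 1, (toIdx s).2.1 + Pi.single i 1, (toIdx s).2.2) =
        toIdx (s + Finsupp.single (some (.inl i)) 1) := by
      rw [toIdx_add, toIdx_single_inl]
      exact Prod.ext rfl (Prod.ext rfl (add_zero _).symm)
    rw [dz_add_single, h, hs, toFam_toIdx, MvPowerSeries.coeff_pderiv, mul_comm]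
    rfl
  · rw [dz_add_single, h, toFam_of_not_inCone, mul_zero]
    intro h'
    refine ht ?_
    simp only [InCone, Pi.add_apply, sum_add_distrib, sum_pi_single', mem_univ, if_true,
      Nat.cast_add, Nat.cast_one] at h' ⊢
    omega

section Exp

variable {σ : Type*}

/-- The exponential of a power series without constant term. -/
noncomputable def expSeries (ψ : MvPowerSeries σ ℂ) : MvPowerSeries σ ℂ := fun s =>
  ∑ m ∈ range (s.degree + 1), ((m.factorial : ℂ))⁻¹ * (ψ ^ m).coeff s

/-- The partial sums of the exponential series. -/
noncomputable def expPartial (ψ : MvPowerSeries σ ℂ) (N : ℕ) : MvPowerSeries σ ℂ :=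
  ∑ m ∈ range N, ((m.factorial : ℂ))⁻¹ • ψ ^ m

lemma coeff_pow_eq_zero {ψ : MvPowerSeries σ ℂ} (hψ : ψ.constantCoeff = 0) {s : σ →₀ ℕ} {m : ℕ}
    (h : s.degree < m) : (ψ ^ m).coeff s = 0 :=
  MvPowerSeries.coeff_of_lt_order <|
    lt_of_lt_of_le (by exact_mod_cast h) (MvPowerSeries.le_order_pow_of_constantCoeff_eq_zero m hψ)

lemma coeff_expSeries {ψ : MvPowerSeries σ ℂ} (hψ : ψ.constantCoeff = 0) {s : σ →₀ ℕ} {N : ℕ}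
    (h : s.degree < N) : (expSeries ψ).coeff s = (expPartial ψ N).coeff s := by
  simp only [expPartial, map_sum, map_smul, smul_eq_mul]
  refine sum_subset (range_subset_range.2 h) fun m _ hm => ?_
  rw [coeff_pow_eq_zero hψ (by simpa using hm), mul_zero]

lemma pderiv_expPartial (ψ : MvPowerSeries σ ℂ) (i : σ) (N : ℕ) :
    MvPowerSeries.pderiv ℂ i (expPartial ψ (N + 1)) =
      expPartial ψ N * MvPowerSeries.pderiv ℂ i ψ := by
  rw [expPartial, sum_range_succ', expPartial, sum_mul]
  simp only [map_add, map_sum, Derivation.map_smul, pow_zero, Derivation.map_one_eq_zero,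
    smul_zero, add_zero]
  refine sum_congr rfl fun m _ => ?_
  rw [Derivation.leibniz_pow, Nat.add_sub_cancel, ← Nat.cast_smul_eq_nsmul ℂ, smul_smul,
    smul_eq_mul, smul_mul_assoc]
  congr 1
  have h₁ : ((m + 1 : ℕ) : ℂ) ≠ 0 := Nat.cast_ne_zero.2 (Nat.succ_ne_zero m)
  rw [Nat.factorial_succ, Nat.cast_mul, mul_inv, mul_right_comm, inv_mul_cancel₀ h₁, one_mul]

lemma pderiv_expSeries {ψ : MvPowerSeries σ ℂ} (hψ : ψ.constantCoeff = 0) (i : σ) :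
    MvPowerSeries.pderiv ℂ i (expSeries ψ) = expSeries ψ * MvPowerSeries.pderiv ℂ i ψ := by
  classical
  ext s
  have hs : (s + Finsupp.single i 1).degree < s.degree + 1 + 1 := by simp
  rw [MvPowerSeries.coeff_pderiv, coeff_expSeries hψ hs, ← MvPowerSeries.coeff_pderiv,
    pderiv_expPartial, MvPowerSeries.coeff_mul, MvPowerSeries.coeff_mul]
  refine sum_congr rfl fun p hp => ?_
  have hp' : p.1.degree < s.degree + 1 := by
    rw [← mem_antidiagonal.1 hp, map_add]
    omega
  rw [coeff_expSeries hψ hp']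

end Exp

/-- The power series of the family `φ / ℏ`. -/
noncomputable def divHbar (φ : WickIdx n → ℂ) : MvPowerSeries (Var n) ℂ := fun s =>
  φ (toIdx s + ((1 : ℤ), 0, 0))

lemma coeff_divHbar (φ : WickIdx n → ℂ) (s : Var n →₀ ℕ) :
    (divHbar φ).coeff s = φ (toIdx s + ((1 : ℤ), 0, 0)) := rfl

lemma lowerBound_divHbar {φ : WickIdx n → ℂ} (hφ : IsFormal φ)
    (hφ3 : ∀ t : WickIdx n, φ t ≠ 0 → 3 ≤ totalDeg t) : LowerBound (-1) 1 (divHbar φ) :=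
  fun s hs => by
  rw [coeff_divHbar] at hs
  have h₁ := hφ.nonneg hs
  have h₂ := hφ3 _ hs
  rw [totalDeg_add] at h₂
  have h₃ : totalDeg (n := n) ((1 : ℤ), 0, 0) = 2 := by simp [totalDeg]
  rw [Prod.fst_add] at h₁
  constructor <;> linarith

lemma LowerBound.constantCoeff {k d : ℤ} {F : MvPowerSeries (Var n) ℂ} (hF : LowerBound k d F)
    (hd : 0 < d) : F.constantCoeff = 0 := by
  by_contra h
  rw [← MvPowerSeries.coeff_zero_eq_constantCoeff_apply] at h
  have h₁ := (hF 0 h).2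
  rw [toIdx_zero] at h₁
  simp [totalDeg] at h₁
  omega

lemma toIdx_single_none (m : ℕ) :
    toIdx (n := n) (Finsupp.single none m) = ((m : ℤ), 0, 0) := by
  refine Prod.ext ?_ (Prod.ext ?_ ?_)
  · simp [toIdx]
  · funext j
    simp [toIdx]
  · funext j
    simp [toIdx]

lemma ofFam_eq_X_mul_divHbar {φ : WickIdx n → ℂ} (hφ : IsFormal φ)
    (hφ3 : ∀ t : WickIdx n, φ t ≠ 0 → 3 ≤ totalDeg t) :
    ofFam φ = MvPowerSeries.X none * divHbar φ := by
  classical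
  ext s
  rw [MvPowerSeries.X, MvPowerSeries.coeff_monomial_mul, one_mul, coeff_ofFam]
  split_ifs with h
  · rw [coeff_divHbar]
    conv_lhs => rw [← tsub_add_cancel_of_le h, toIdx_add, toIdx_single_none]
    rfl
  · by_contra hne
    have hs : s none = 0 := by
      by_contra h0
      refine h fun v => ?_
      by_cases hv : v = none
      · subst hv; simp; omega
      · simp [Ne.symm hv]
    have h₁ := hφ.nonneg hne
    have h₂ := hφ3 _ hne
    simp only [toIdx, totalDeg, hs, Nat.cast_zero] at h₁ h₂
    omega

lemma toFam_X_pow_mul (F : MvPowerSeries (Var n) ℂ) (m : ℕ) (t : WickIdx n) :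
    toFam (MvPowerSeries.X none ^ m * F) (t.1 + m, t.2.1, t.2.2) = toFam F t := by
  classical
  have hadd : ((t.1 + m, t.2.1, t.2.2) : WickIdx n) = t + toIdx (Finsupp.single none m) := by
    rw [toIdx_single_none]
    exact Prod.ext rfl (by simp)
  rw [MvPowerSeries.X_pow_eq, hadd]
  by_cases ht : InCone t
  · rw [← toIdx_ofIdx ht, ← toIdx_add, toFam_toIdx, toFam_toIdx,
      add_comm (ofIdx t), MvPowerSeries.coeff_add_monomial_mul, one_mul]
  · rw [toFam_of_not_inCone F ht]
    by_contra h
    obtain ⟨s, hs, hne⟩ := exists_toIdx_of_toFam_ne_zero h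
    rw [MvPowerSeries.coeff_monomial_mul] at hne
    split_ifs at hne with hle
    · rw [← tsub_add_cancel_of_le hle, toIdx_add] at hs
      exact ht (add_right_cancel hs ▸ inCone_toIdx _)
    · exact hne rfl

lemma toFam_one : toFam (1 : MvPowerSeries (Var n) ℂ) = cOne := by
  classical
  refine (toFam_eq_of_toIdx (fun s => ?_) fun t ht => ?_).symm
  · rw [MvPowerSeries.coeff_one, cOne]
    have : toIdx s = ((0 : ℤ), (0 : Fin n → ℕ), (0 : Fin n → ℕ)) ↔ s = 0 := by
      rw [← toIdx_injective.eq_iff, toIdx_zero]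
      rfl
    simp only [this]
  · rw [cOne, if_neg]
    rintro rfl
    exact ht (inCone_of_nonneg le_rfl)

lemma cPow_eq_toFam {φ : WickIdx n → ℂ} (hφ : IsFormal φ) (m : ℕ) :
    cPow φ m = toFam (ofFam φ ^ m) := by
  induction m with
  | zero => rw [pow_zero, toFam_one, cPow]
  | succ m ih =>
    rw [cPow, ih, pow_succ', ← cMul_toFam, toFam_ofFam hφ]

lemma wickExp_eq_toFam {φ : WickIdx n → ℂ} (hφ : IsFormal φ)
    (hφ3 : ∀ t : WickIdx n, φ t ≠ 0 → 3 ≤ totalDeg t) :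
    wickExp φ = toFam (expSeries (divHbar φ)) := by
  have hc := (lowerBound_divHbar hφ hφ3).constantCoeff one_pos
  have hterm : ∀ t m, expTerm φ t m = ((m.factorial : ℂ))⁻¹ * toFam (divHbar φ ^ m) t :=
    fun t m => by
    rw [expTerm, cPow_eq_toFam hφ, ofFam_eq_X_mul_divHbar hφ hφ3, mul_pow, toFam_X_pow_mul]
  refine toFam_eq_of_toIdx (fun s => ?_) fun t ht => ?_
  · simp only [wickExp, hterm, toFam_toIdx]
    refine finsum_eq_sum_of_support_subset (s := range (s.degree + 1)) _ fun m hm => ?_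
    by_contra h
    refine hm ?_
    simp only [coe_range, Set.mem_Iio, not_lt] at h
    simp only [coeff_pow_eq_zero hc h, mul_zero]
  · simp [wickExp, hterm, toFam_of_not_inCone _ ht]

lemma coeff_expSeries_of_totalDeg_nonpos {ψ : MvPowerSeries (Var n) ℂ} {k : ℤ}
    (hψ : LowerBound k 1 ψ) {s : Var n →₀ ℕ} (hs : totalDeg (toIdx s) ≤ 0) :
    (expSeries ψ).coeff s = MvPowerSeries.coeff s 1 := by
  change ∑ m ∈ range (s.degree + 1), ((m.factorial : ℂ))⁻¹ * (ψ ^ m).coeff s = _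
  rw [sum_eq_single_of_mem 0 (mem_range.2 (Nat.succ_pos _))]
  · simp
  · intro m _ hm
    by_contra h
    have h₁ := (hψ.pow m s (right_ne_zero_of_mul h)).2
    rw [mul_one] at h₁
    omega

lemma isUnipotent_toFam_expSeries {ψ : MvPowerSeries (Var n) ℂ} {k : ℤ}
    (hψ : LowerBound k 1 ψ) : IsUnipotent (toFam (expSeries ψ)) where
  apply_zero := by
    rw [← toIdx_zero, toFam_toIdx, coeff_expSeries_of_totalDeg_nonpos hψ]
    · simp
    · simp [toIdx_zero, totalDeg]
  eq_or_pos t ht := by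
    classical
    obtain ⟨s, rfl, hs⟩ := exists_toIdx_of_toFam_ne_zero ht
    refine or_iff_not_imp_right.2 fun h => ?_
    rw [coeff_expSeries_of_totalDeg_nonpos hψ (not_lt.1 h), MvPowerSeries.coeff_one] at hs
    rw [(ite_ne_right_iff.1 hs).1, toIdx_zero]

lemma exists_dz_toFam_expSeries {ψ : MvPowerSeries (Var n) ℂ} (hψ : LowerBound (-1) 1 ψ)
    (γ : Fin n → ℕ) : ∃ P, LowerBound 0 (∑ i, γ i : ℕ) P ∧
      dz γ (toFam (expSeries ψ)) = toFam (expSeries ψ * P) := by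
  induction hN : ∑ i, γ i generalizing γ with
  | zero =>
    have : γ = 0 := by
      funext i
      exact (sum_eq_zero_iff.1 hN) i (mem_univ i)
    exact ⟨1, lowerBound_one, by rw [this, dz_zero, mul_one]⟩
  | succ N ih =>
    obtain ⟨i, -, hi⟩ := exists_ne_zero_of_sum_ne_zero (hN.trans_ne (Nat.succ_ne_zero N))
    obtain ⟨δ, rfl⟩ : ∃ δ, γ = δ + Pi.single i 1 := by
      refine ⟨γ - Pi.single i 1, (tsub_add_cancel_of_le fun j => ?_).symm⟩
      by_cases hj : j = i
      · subst hj
        rw [Pi.single_eq_same]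
        exact Nat.one_le_iff_ne_zero.2 hi
      · simp [hj]
    have hδ : ∑ j, δ j = N := by
      simpa [sum_add_distrib] using hN
    obtain ⟨P, hP, hdz⟩ := ih δ hδ
    refine ⟨MvPowerSeries.pderiv ℂ (some (.inl i)) P +
      P * MvPowerSeries.pderiv ℂ (some (.inl i)) ψ, ?_, ?_⟩
    · refine LowerBound.add ((hP.pderiv i).mono ?_ ?_) ((hP.mul (hψ.pderiv i)).mono ?_ ?_) <;>
        push_cast <;> linarith
    · rw [dz_single_toFam hdz, Derivation.leibniz,
        pderiv_expSeries (hψ.constantCoeff one_pos), smul_eq_mul, smul_eq_mul]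
      congr 1
      ring

lemma toFam_sum {ι : Type*} (S : Finset ι) (F : ι → MvPowerSeries (Var n) ℂ) (t : WickIdx n) :
    toFam (∑ i ∈ S, F i) t = ∑ i ∈ S, toFam (F i) t := by
  unfold toFam
  split_ifs <;> simp

lemma toFam_smul (a : ℂ) (F : MvPowerSeries (Var n) ℂ) (t : WickIdx n) :
    toFam (a • F) t = a * toFam F t := by
  unfold toFam
  split_ifs <;> simp

/-- For `O ∈ 𝒲` the product `e^ψ ⋆ O` is of the form `x · e^ψ` with `x ∈ 𝒲`. -/
lemma exists_cMul_eq_wickMul {ψ : MvPowerSeries (Var n) ℂ} (hψ : LowerBound (-1) 1 ψ)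
    {O : WickIdx n → ℂ} (hO : IsFormal O) :
    ∃ x, IsFormal x ∧ cMul x (toFam (expSeries ψ)) = wickMul (toFam (expSeries ψ)) O := by
  classical
  have hε := isUnipotent_toFam_expSeries hψ
  choose P hP hdz using exists_dz_toFam_expSeries hψ
  let Q : (Fin n → ℕ) → MvPowerSeries (Var n) ℂ := fun γ =>
    wickCoeff γ • (P γ * ofFam (dzbar γ O))
  have hQ : ∀ γ, LowerBound 0 (∑ i, γ i : ℕ) (Q γ) := fun γ s hs => by
    have := (hP γ).mul (lowerBound_ofFam (hO.dzbar γ)) s fun h => hs (by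
      rw [MvPowerSeries.coeff_smul, h, mul_zero])
    simpa only [add_zero] using this
  let X : MvPowerSeries (Var n) ℂ := fun s =>
    ∑ γ ∈ Iic (fun _ : Fin n => (totalDeg (toIdx s)).toNat), (Q γ).coeff s
  have hX : LowerBound 0 0 X := fun s hs => by
    obtain ⟨γ, -, hγ⟩ := exists_ne_zero_of_sum_ne_zero (s := Iic _) hs
    exact (hQ γ).mono le_rfl (Int.natCast_nonneg _) s hγ
  have hX_coeff : ∀ s (N : ℕ), totalDeg (toIdx s) ≤ N →
      X.coeff s = (∑ γ ∈ Iic (fun _ : Fin n => N), Q γ).coeff s := fun s N hN => by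
    rw [map_sum]
    refine sum_subset (Iic_subset_Iic.2 fun _ => Int.toNat_le.2 hN) fun γ _ hγ => ?_
    by_contra h
    refine hγ (mem_Iic.2 fun i => ?_)
    have h₁ := (hQ γ s h).2
    have h₂ : γ i ≤ ∑ i, γ i := single_le_sum (fun _ _ => Nat.zero_le _) (mem_univ i)
    simp only
    omega
  refine ⟨toFam X, isFormal_toFam hX, ?_⟩
  rw [cMul_toFam, mul_comm]
  funext t
  set N := (totalDeg t).toNat with hN
  have hwick : wickMul (toFam (expSeries ψ)) O t =
      toFam (expSeries ψ * ∑ γ ∈ Iic (fun _ : Fin n => N), Q γ) t := by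
    rw [wickMul_eq_sum hε hO t (Int.self_le_toNat _), mul_sum, toFam_sum]
    refine sum_congr rfl fun γ _ => ?_
    rw [hdz, ← toFam_ofFam (hO.dzbar γ), cMul_toFam, ← toFam_smul, mul_assoc, ← mul_smul_comm]
  rw [hwick]
  by_cases ht : InCone t
  · rw [← toIdx_ofIdx ht, toFam_toIdx, toFam_toIdx, MvPowerSeries.coeff_mul,
      MvPowerSeries.coeff_mul]
    refine sum_congr rfl fun p hp => ?_
    by_cases h0 : (expSeries ψ).coeff p.1 = 0
    · rw [h0, zero_mul, zero_mul]
    · rw [← toFam_toIdx] at h0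
      have h₁ := hε.totalDeg_nonneg h0
      have h₂ := congrArg (fun s => totalDeg (toIdx s)) (mem_antidiagonal.1 hp)
      simp only [toIdx_add, totalDeg_add, toIdx_ofIdx ht] at h₂
      rw [hX_coeff p.2 N (by omega)]
  · rw [toFam_of_not_inCone _ ht, toFam_of_not_inCone _ ht]

end WickAlgebra

/-- Let `φ ∈ 𝒲` have all nonzero monomials of total degree `≥ 3`, so that `e^{φ/ℏ}` is a
well-defined invertible element of `𝒲⁺`. Then for every `f ∈ 𝒲` there is a unique
`O_f ∈ 𝒲` with `f · e^{φ/ℏ} = e^{φ/ℏ} ⋆ O_f` (commutative product on the left, Wick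
product on the right); moreover if `f` is a single monomial `c·ℏ^{k₀} z^{α₀} z̄^{β₀}`,
then `O_f = f +` terms of total degree strictly greater than that of `f`. -/
theorem exists_unique_Of_and_leading_term (n : ℕ) (φ : WickIdx n → ℂ)
    (hφW : ∀ t : WickIdx n, t.1 < 0 → φ t = 0)
    (hφ3 : ∀ t : WickIdx n, φ t ≠ 0 → 3 ≤ totalDeg t) :
    (∀ f : WickIdx n → ℂ, (∀ t : WickIdx n, t.1 < 0 → f t = 0) →
      ∃! O : WickIdx n → ℂ, (∀ t : WickIdx n, t.1 < 0 → O t = 0) ∧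
        cMul f (wickExp φ) = wickMul (wickExp φ) O) ∧
    (∀ t₀ : WickIdx n, 0 ≤ t₀.1 → ∀ c : ℂ, c ≠ 0 →
      ∀ O : WickIdx n → ℂ, (∀ t : WickIdx n, t.1 < 0 → O t = 0) →
        cMul (fun t => if t = t₀ then c else 0) (wickExp φ) = wickMul (wickExp φ) O →
        O t₀ = c ∧ ∀ t : WickIdx n, O t ≠ 0 → t = t₀ ∨ totalDeg t₀ < totalDeg t) := by
  have hψ := WickAlgebra.lowerBound_divHbar hφW hφ3
  rw [WickAlgebra.wickExp_eq_toFam hφW hφ3]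
  have hε := WickAlgebra.isUnipotent_toFam_expSeries hψ
  refine ⟨fun f hf => ?_, fun t₀ _ c _ O hO h => ?_⟩
  · obtain ⟨O, hO, hOε⟩ := WickAlgebra.exists_wickMul_eq hε
      (fun _ hO => WickAlgebra.exists_cMul_eq_wickMul hψ hO) hf
    exact ⟨O, ⟨hO, hOε⟩, fun O' hO' =>
      WickAlgebra.wickMul_injective hε hO'.1 hO (hO'.2.symm.trans hOε)⟩
  · have key : ∀ t, totalDeg t ≤ totalDeg t₀ → O t = if t = t₀ then c else 0 := fun t ht =>
      WickAlgebra.eq_of_vanish_left hε hO h (d := totalDeg t₀)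
        (fun s hs => if_neg (by rintro rfl; exact lt_irrefl _ hs)) ht
    refine ⟨by rw [key t₀ le_rfl, if_pos rfl], fun t ht => ?_⟩
    by_contra! h'
    exact ht (by rw [key t h'.2, if_neg h'.1])
end
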